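/- arXiv:2010.03103 — 4 statements merged into one kernel-verified Lean document; each statement's English description precedes it below -/
import Mathlib

section
/- Let d ∈ ℕ, let Ω be a compact subset of ℝ^d equipped with a probability measure μ, and let F be a compact subset of C(Ω). Then there exist two positive absolute constants b and B (independent of d, Ω, μ, F, and n) such that for every n ∈ ℕ, ϱ_{⌈bn⌉}(F, L_2) ≤ B · d_n(F, L_∞). -/
open MeasureTheory ENNReal

noncomputable section

/-- The `L_p(Ω,μ)` norm `(∫ |f|^p dμ)^{1/p}` of a complex valued function,
as an extended nonnegative real. -/
def lpNormE {α : Type*} [MeasurableSpace α] (μ : Measure α) (p : ℝ) (f : α → ℂ) : ℝ≥0∞ :=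
  (∫⁻ x, (‖f x‖₊ : ℝ≥0∞) ^ p ∂μ) ^ (1 / p)

/-- The uniform norm `max_{x ∈ Ω} |f(x)|` (as a supremum in `ℝ≥0∞`). -/
def supNormE {α : Type*} (f : α → ℂ) : ℝ≥0∞ :=
  ⨆ x, (‖f x‖₊ : ℝ≥0∞)

/-- The error `ϱ_m(F, L_p)` of optimal linear recovery from `m` point samples,
measured in the `L_p(Ω,μ)` norm: the infimum over sets of `m` sample points
`ξ = {ξ^1, …, ξ^m} ⊆ Ω` and linear operators `Φ_ξ : ℂ^m → L_p` of
`sup_{f ∈ F} ‖f - Φ_ξ(f(ξ^1), …, f(ξ^m))‖_p`. -/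
def recovE {α : Type*} [TopologicalSpace α] [MeasurableSpace α] (μ : Measure α) (p : ℝ)
    (F : Set C(α, ℂ)) (m : ℕ) : ℝ≥0∞ :=
  ⨅ (ξ : Fin m → α) (Φ : (Fin m → ℂ) →ₗ[ℂ] C(α, ℂ)),
    ⨆ f : F, lpNormE μ p (fun x => (f : C(α, ℂ)) x - Φ (fun j => (f : C(α, ℂ)) (ξ j)) x)

/-- The Kolmogorov width `d_n(F, L_∞)` of `F` in the uniform norm. -/
def kolmWidthInfE {α : Type*} [TopologicalSpace α] (F : Set C(α, ℂ)) (n : ℕ) : ℝ≥0∞ :=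
  ⨅ u : Fin n → C(α, ℂ), ⨆ f : F, ⨅ c : Fin n → ℂ,
    supNormE (fun x => (f : C(α, ℂ)) x - ∑ i, c i * u i x)

open Matrix ComplexOrder in
lemma Matrix.diagonal_add_vecMulVec_mul_eq_one {ι : Type*} [Fintype ι] [DecidableEq ι]
    {p : ι → ℝ} (hp : ∀ i, 0 < p i) (w : ι → ℂ) :
    (diagonal (fun i => (p i : ℂ)) + (2 : ℂ) • vecMulVec w (star w)) *
      (diagonal (fun i => (p i : ℂ)⁻¹) - (((1 / 2 + ∑ i, ‖w i‖ ^ 2 / p i)⁻¹ : ℝ) : ℂ) •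
        vecMulVec (fun i => w i / p i) (star fun i => w i / p i)) = 1 := by
  have hpc : ∀ i, (p i : ℂ) ≠ 0 := fun i => by exact_mod_cast (hp i).ne'
  set t : ℝ := ∑ i, ‖w i‖ ^ 2 / p i with ht
  have ht0 : 0 ≤ t := Finset.sum_nonneg fun i _ => by have := hp i; positivity
  set z : ι → ℂ := fun i => w i / p i with hz
  have h1 : diagonal (fun i => (p i : ℂ)) * diagonal (fun i => (p i : ℂ)⁻¹) = 1 := by
    rw [diagonal_mul_diagonal, ← diagonal_one]
    congr 1; ext i; exact mul_inv_cancel₀ (hpc i)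
  have h2 : diagonal (fun i => (p i : ℂ)) * vecMulVec z (star z) = vecMulVec w (star z) := by
    ext i j
    simp only [diagonal_mul, vecMulVec_apply, hz]
    field_simp [hpc i]
  have h3 : vecMulVec w (star w) * diagonal (fun i => (p i : ℂ)⁻¹) = vecMulVec w (star z) := by
    ext i j
    simp [mul_diagonal, vecMulVec_apply, hz, div_eq_mul_inv, mul_assoc]
  have h4 : vecMulVec w (star w) * vecMulVec z (star z) = (t : ℂ) • vecMulVec w (star z) := by
    rw [vecMulVec_mul_vecMulVec]
    have : star w ⬝ᵥ z = (t : ℂ) := by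
      simp only [dotProduct, hz, ht, Pi.star_apply, RCLike.star_def]
      push_cast
      refine Finset.sum_congr rfl fun i _ => ?_
      rw [← mul_div_assoc, Complex.conj_mul']
    rw [this]
    ext i j
    simp [vecMulVec_apply, mul_left_comm]
  rw [add_mul, mul_sub, mul_sub, h1, Matrix.mul_smul, h2, Matrix.smul_mul, h3, Matrix.smul_mul,
    Matrix.mul_smul, h4]
  have h5 : (2 : ℂ) - (((1 / 2 + t)⁻¹ : ℝ) : ℂ) - 2 * (((1 / 2 + t)⁻¹ : ℝ) : ℂ) * t = 0 := by
    have : (2 : ℝ) - (1 / 2 + t)⁻¹ - 2 * (1 / 2 + t)⁻¹ * t = 0 := by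
      have : (1 / 2 + t) ≠ 0 := by positivity
      field_simp; ring
    exact_mod_cast this
  have h6 : ((2 : ℂ) - (((1 / 2 + t)⁻¹ : ℝ) : ℂ) - 2 * (((1 / 2 + t)⁻¹ : ℝ) : ℂ) * t) •
      vecMulVec w (star z) = 0 := by rw [h5, zero_smul]
  rw [sub_smul, sub_smul] at h6
  rw [smul_smul, smul_smul]
  rw [sub_add_eq_add_sub, ← add_sub_assoc, ← sub_eq_zero]
  rw [← h6]
  abel

lemma sum_inv_sub_inv_le {ι : Type*} [Fintype ι] {m : ι → ℝ} (hm : ∀ i, 0 < m i)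
    (hsum : ∑ i, (m i)⁻¹ ≤ 1 / 2) :
    (∀ i, 0 < m i - 1) ∧
    (∑ i, ((m i - 1)⁻¹ - (m i)⁻¹)) * (1 / 2 + ∑ i, (m i - 1)⁻¹) ≤ ∑ i, ((m i - 1)⁻¹) ^ 2 := by
  have hp : ∀ i, 0 < m i - 1 := fun i => by
    have h1 : (m i)⁻¹ ≤ 1 / 2 :=
      (Finset.single_le_sum (f := fun i => (m i)⁻¹) (fun j _ => (inv_pos.2 (hm j)).le)
        (Finset.mem_univ i)).trans hsum
    have h2 : m i * (m i)⁻¹ = 1 := mul_inv_cancel₀ (hm i).ne'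
    nlinarith [hm i]
  refine ⟨hp, ?_⟩
  set D := ∑ i, ((m i - 1)⁻¹ - (m i)⁻¹) with hD
  set S := ∑ i, (m i)⁻¹ with hS
  set E := ∑ i, ((m i - 1)⁻¹ ^ 2 * (m i)⁻¹) with hE
  have hE0 : 0 ≤ E := Finset.sum_nonneg fun i _ => by have := hp i; have := hm i; positivity
  have hD0 : 0 ≤ D := Finset.sum_nonneg fun i _ =>
    sub_nonneg.2 (inv_anti₀ (hp i) (by linarith))
  have hP : ∑ i, (m i - 1)⁻¹ = D + S := by rw [hD, hS, ← Finset.sum_add_distrib]; simp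
  have hQ : ∑ i, ((m i - 1)⁻¹) ^ 2 = D + E := by
    rw [hD, hE, ← Finset.sum_add_distrib]
    refine Finset.sum_congr rfl fun i _ => ?_
    have := (hp i).ne'; have := (hm i).ne'
    field_simp; ring
  have hCS : D ^ 2 ≤ E * S := by
    refine Finset.sum_sq_le_sum_mul_sum_of_sq_le_mul _ (fun i _ => ?_) (fun i _ => ?_)
      (fun i _ => le_of_eq ?_)
    · have := hp i; have := hm i; positivity
    · exact (inv_pos.2 (hm i)).le
    · have := (hp i).ne'; have := (hm i).ne'
      field_simp; ring
  rw [hP, hQ]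
  nlinarith

open Matrix ComplexOrder in
lemma Matrix.trace_inv_of_eq_unitary_conj {ι : Type*} [Fintype ι] [DecidableEq ι] {A U : Matrix ι ι ℂ}
    (hU : U ∈ unitaryGroup ι ℂ) {D E : Matrix ι ι ℂ} (hA : A = U * D * star U)
    (hDE : D * E = 1) : A⁻¹.trace = E.trace := by
  have h1 : star U * U = 1 := mem_unitaryGroup_iff'.1 hU
  have h2 : U * star U = 1 := mem_unitaryGroup_iff.1 hU
  have : A⁻¹ = U * E * star U := by
    refine inv_eq_right_inv ?_
    rw [hA]
    calc U * D * star U * (U * E * star U) = U * (D * ((star U * U) * E)) * star U := by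
          simp only [Matrix.mul_assoc]
      _ = 1 := by rw [h1, Matrix.one_mul, hDE, Matrix.mul_one, h2]
  rw [this, Matrix.trace_mul_comm, ← Matrix.mul_assoc, h1, Matrix.one_mul]

open Matrix ComplexOrder in
/-- One step of the lower barrier argument of Batson, Spielman and Srivastava: averaging over `μ`
yields a point whose rank one update compensates lowering the matrix by the identity. -/
lemma Matrix.PosDef.exists_lower_barrier_step {ι α : Type*} [Fintype ι] [DecidableEq ι]
    [MeasurableSpace α] {μ : Measure α} [IsProbabilityMeasure μ] {v : ι → α → ℂ}
    (hint : ∀ c : ι → ℂ, Integrable (fun x => ‖∑ i, c i * v i x‖ ^ 2) μ)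
    (hnorm : ∀ c : ι → ℂ, ∫ x, ‖∑ i, c i * v i x‖ ^ 2 ∂μ = ∑ i, ‖c i‖ ^ 2)
    {Z : Set α} (hZ : μ Z = 0) {M : Matrix ι ι ℂ} (hM : M.PosDef) (htr : M⁻¹.trace.re ≤ 1 / 2) :
    ∃ x ∉ Z, ∃ M' : Matrix ι ι ℂ,
      M' = M - 1 + (2 : ℂ) • vecMulVec (star fun i => v i x) (fun i => v i x) ∧
      M'.PosDef ∧ M'⁻¹.trace.re ≤ 1 / 2 := by
  set m := hM.isHermitian.eigenvalues
  set U : Matrix ι ι ℂ := ↑hM.isHermitian.eigenvectorUnitary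
  have hU : U ∈ unitaryGroup ι ℂ := SetLike.coe_mem _
  have hUU : star U * U = 1 := mem_unitaryGroup_iff'.1 hU
  have hUU' : U * star U = 1 := mem_unitaryGroup_iff.1 hU
  have hm : ∀ i, 0 < m i := hM.eigenvalues_pos
  have hspec : M = U * diagonal (fun i => (m i : ℂ)) * star U := by
    have := hM.isHermitian.spectral_theorem
    rwa [Unitary.conjStarAlgAut_apply] at this
  have htrM : M⁻¹.trace = ((∑ i, (m i)⁻¹ : ℝ) : ℂ) := by
    rw [Matrix.trace_inv_of_eq_unitary_conj hU hspec (E := diagonal fun i => (m i : ℂ)⁻¹), trace_diagonal]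
    · push_cast; rfl
    · rw [diagonal_mul_diagonal, ← diagonal_one]
      congr 1; ext i
      exact mul_inv_cancel₀ (by exact_mod_cast (hm i).ne')
  rw [htrM, Complex.ofReal_re] at htr
  obtain ⟨hp, hineq⟩ := sum_inv_sub_inv_le hm htr
  set p : ι → ℝ := fun i => m i - 1 with hpdef
  set D := ∑ i, ((m i - 1)⁻¹ - (m i)⁻¹) with hD
  set w : α → ι → ℂ := fun x i => star (∑ k, U k i * v k x) with hw
  have hwnorm : ∀ x i, ‖w x i‖ ^ 2 = ‖∑ k, U k i * v k x‖ ^ 2 := fun x i => by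
    simp only [hw, norm_star]
  have hcol : ∀ i, ∑ k, ‖U k i‖ ^ 2 = 1 := fun i => by
    have h := congrFun (congrFun hUU i) i
    rw [Matrix.mul_apply, Matrix.one_apply_eq] at h
    have h' : ((∑ k, ‖U k i‖ ^ 2 : ℝ) : ℂ) = 1 := by
      rw [← h]; push_cast
      refine Finset.sum_congr rfl fun k _ => ?_
      rw [Matrix.star_apply, RCLike.star_def, Complex.conj_mul']
    exact_mod_cast h'
  have hwint : ∀ i, Integrable (fun x => ‖w x i‖ ^ 2) μ := fun i => by
    simp only [hwnorm]; exact hint _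
  have hwone : ∀ i, ∫ x, ‖w x i‖ ^ 2 ∂μ = 1 := fun i => by
    simp only [hwnorm]; rw [hnorm, hcol]
  have hgint : ∀ i ∈ Finset.univ, Integrable
      (fun x => ‖w x i‖ ^ 2 * ((p i)⁻¹ ^ 2 - D * (p i)⁻¹)) μ := fun i _ => (hwint i).mul_const _
  obtain ⟨x, hxZ, hx⟩ := exists_notMem_null_integral_le (integrable_finsetSum _ hgint) hZ
  rw [integral_finsetSum _ hgint] at hx
  simp only [integral_mul_const, hwone, one_mul] at hx
  refine ⟨x, hxZ, _, rfl, ?_⟩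
  set t := ∑ i, ‖w x i‖ ^ 2 / p i with ht
  have ht0 : 0 ≤ t := Finset.sum_nonneg fun i _ => by have := hp i; positivity
  set s := ∑ i, ‖w x i‖ ^ 2 / p i ^ 2 with hs
  have hxs : D * (1 / 2 + t) ≤ s := by
    have h1 : ∑ i, ‖w x i‖ ^ 2 * ((p i)⁻¹ ^ 2 - D * (p i)⁻¹) = s - D * t := by
      rw [hs, ht, Finset.mul_sum, ← Finset.sum_sub_distrib]
      refine Finset.sum_congr rfl fun i _ => ?_
      rw [div_eq_mul_inv, div_eq_mul_inv, inv_pow]; ring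
    have h2 : ∑ i, ((p i)⁻¹ ^ 2 - D * (p i)⁻¹) = ∑ i, (p i)⁻¹ ^ 2 - D * ∑ i, (p i)⁻¹ := by
      rw [Finset.mul_sum, ← Finset.sum_sub_distrib]
    rw [h1, h2] at hx
    simp only [hpdef] at hx
    linarith
  set M' := M - 1 + (2 : ℂ) • vecMulVec (star fun i => v i x) (fun i => v i x) with hM'
  have hUw : U *ᵥ (w x) = star fun i => v i x := by
    have : w x = star U *ᵥ (star fun i => v i x) := by
      ext i
      simp [hw, mulVec, dotProduct, Matrix.star_apply]
    rw [this, mulVec_mulVec, hUU', one_mulVec]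
  have hfac : M' = U * (diagonal (fun i => (p i : ℂ)) + (2 : ℂ) • vecMulVec (w x) (star (w x)))
      * star U := by
    have e1 : diagonal (fun i => (p i : ℂ)) = diagonal (fun i => (m i : ℂ)) - 1 := by
      rw [← diagonal_one, diagonal_sub]; simp [hpdef]
    have e2 : U * vecMulVec (w x) (star (w x)) * star U
        = vecMulVec (star fun i => v i x) (fun i => v i x) := by
      rw [mul_vecMulVec, vecMulVec_mul, hUw]
      have : star (w x) ᵥ* star U = star (U *ᵥ w x) := by
        rw [star_mulVec]; rfl
      rw [this, hUw, star_star]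
    rw [hM', e1, mul_add, mul_sub, add_mul, sub_mul, ← hspec, Matrix.mul_one, hUU',
      Matrix.mul_smul, Matrix.smul_mul, e2]
  refine ⟨?_, ?_⟩
  · rw [hfac]
    refine Matrix.PosDef.mul_mul_conjTranspose_same ?_ ?_
    · refine Matrix.PosDef.add_posSemidef ?_ ?_
      · rw [posDef_diagonal_iff]
        intro i
        exact_mod_cast hp i
      · exact (posSemidef_vecMulVec_self_star _).smul (by norm_num)
    · intro a b hab
      have := congrArg (fun c => c ᵥ* star U) hab
      simpa [vecMul_vecMul, hUU'] using this
  · rw [Matrix.trace_inv_of_eq_unitary_conj hU hfac (diagonal_add_vecMulVec_mul_eq_one hp (w x)),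
      trace_sub, trace_diagonal, trace_smul, trace_vecMulVec]
    have e3 : ((fun i => w x i / (p i : ℂ)) ⬝ᵥ star fun i => w x i / (p i : ℂ)) = (s : ℂ) := by
      simp only [dotProduct, Pi.star_apply, RCLike.star_def, hs]
      push_cast
      refine Finset.sum_congr rfl fun i _ => ?_
      rw [Complex.mul_conj', norm_div, Complex.norm_real, Real.norm_of_nonneg (hp i).le]
      rw [Complex.ofReal_div, div_pow]
    rw [e3, smul_eq_mul]
    have e4 : (∑ i, ((p i : ℂ))⁻¹ - (((1 / 2 + t)⁻¹ : ℝ) : ℂ) * (s : ℂ)).re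
        = ∑ i, (p i)⁻¹ - (1 / 2 + t)⁻¹ * s := by
      rw [← Complex.ofReal_re (∑ i, (p i)⁻¹ - (1 / 2 + t)⁻¹ * s)]
      push_cast; rfl
    rw [e4]
    have h3 : D ≤ (1 / 2 + t)⁻¹ * s := by
      rw [inv_mul_eq_div, le_div_iff₀ (by positivity)]; exact hxs
    have h4 : ∑ i, (p i)⁻¹ = D + ∑ i, (m i)⁻¹ := by
      rw [hD, ← Finset.sum_add_distrib]; simp [hpdef]
    linarith

open Matrix ComplexOrder in
/-- Equal weight lower discretization of the `L₂` norm at `4 n` points, on a space with an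
orthonormal system of size at most `n`. -/
lemma exists_points_le_sum_norm_sq {N n : ℕ} (hNn : N ≤ n) {α : Type*} [MeasurableSpace α]
    {μ : Measure α} [IsProbabilityMeasure μ] {v : Fin N → α → ℂ}
    (hint : ∀ c : Fin N → ℂ, Integrable (fun x => ‖∑ i, c i * v i x‖ ^ 2) μ)
    (hnorm : ∀ c : Fin N → ℂ, ∫ x, ‖∑ i, c i * v i x‖ ^ 2 ∂μ = ∑ i, ‖c i‖ ^ 2)
    {Z : Set α} (hZ : μ Z = 0) :
    ∃ ξ : Fin (4 * n) → α, (∀ j, ξ j ∉ Z) ∧ ∀ c : Fin N → ℂ,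
      n * ∑ i, ‖c i‖ ^ 2 ≤ ∑ j, ‖∑ i, c i * v i (ξ j)‖ ^ 2 := by
  have key : ∀ k : ℕ, ∃ ξ : Fin k → α, (∀ j, ξ j ∉ Z) ∧ ∃ M : Matrix (Fin N) (Fin N) ℂ,
      M = (2 * N - k : ℂ) • 1 +
        (2 : ℂ) • ∑ j, vecMulVec (star fun i => v i (ξ j)) (fun i => v i (ξ j)) ∧
      M.PosDef ∧ M⁻¹.trace.re ≤ 1 / 2 := by
    intro k
    induction k with
    | zero =>
      refine ⟨Fin.elim0, fun j => j.elim0, _, rfl, ?_⟩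
      rcases Nat.eq_zero_or_pos N with rfl | hN
      · refine ⟨?_, by simp [Matrix.trace]⟩
        rw [Subsingleton.elim (_ + _) (1 : Matrix (Fin 0) (Fin 0) ℂ)]
        exact Matrix.PosDef.one
      · have hN' : (N : ℂ) ≠ 0 := by exact_mod_cast hN.ne'
        simp only [Finset.univ_eq_empty, Finset.sum_empty, smul_zero, add_zero, Nat.cast_zero,
          sub_zero]
        refine ⟨Matrix.PosDef.one.smul (by exact_mod_cast (by positivity : 0 < 2 * N)), ?_⟩
        rw [inv_eq_right_inv (B := (2 * N : ℂ)⁻¹ • 1)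
          (by simp only [Matrix.mul_smul, mul_one, smul_smul]
              rw [inv_mul_cancel₀ (by simpa using hN'), one_smul])]
        rw [trace_smul, trace_one, Fintype.card_fin, smul_eq_mul]
        have : (2 * N : ℂ)⁻¹ * N = ((1 / 2 : ℝ) : ℂ) := by push_cast; field_simp
        rw [this, Complex.ofReal_re]
    | succ k ih =>
      obtain ⟨ξ, hξ, M, hMeq, hM, htr⟩ := ih
      obtain ⟨x, hx, M', hM'eq, hM', htr'⟩ := hM.exists_lower_barrier_step hint hnorm hZ htr
      refine ⟨Fin.cons x ξ, fun j => ?_, M', ?_, hM', htr'⟩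
      · refine Fin.cases ?_ (fun j => ?_) j
        · simpa using hx
        · simpa using hξ j
      · rw [hM'eq, hMeq, Fin.sum_univ_succ]
        simp only [Fin.cons_zero, Fin.cons_succ]
        push_cast
        module
  obtain ⟨ξ, hξ, M, hMeq, hM, -⟩ := key (4 * n)
  refine ⟨ξ, hξ, fun c => ?_⟩
  have h0 := hM.posSemidef.re_dotProduct_nonneg c
  have h1 : star c ⬝ᵥ M *ᵥ c =
      (((2 * N - (4 * n : ℕ)) * ∑ i, ‖c i‖ ^ 2 +
        2 * ∑ j, ‖∑ i, c i * v i (ξ j)‖ ^ 2 : ℝ) : ℂ) := by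
    have e1 : star c ⬝ᵥ c = ((∑ i, ‖c i‖ ^ 2 : ℝ) : ℂ) := by
      simp only [dotProduct, Pi.star_apply, RCLike.star_def]
      push_cast
      exact Finset.sum_congr rfl fun i _ => Complex.conj_mul' _
    have e2 : ∀ j, star c ⬝ᵥ vecMulVec (star fun i => v i (ξ j)) (fun i => v i (ξ j)) *ᵥ c =
        ((‖∑ i, c i * v i (ξ j)‖ ^ 2 : ℝ) : ℂ) := fun j => by
      have e3 : (fun i => v i (ξ j)) ⬝ᵥ c = ∑ i, c i * v i (ξ j) := by
        simp [dotProduct, mul_comm]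
      rw [vecMulVec_mulVec, dotProduct_smul, star_dotProduct_star, e3]
      simp only [MulOpposite.smul_eq_mul_unop, MulOpposite.unop_op, RCLike.star_def]
      rw [Complex.conj_mul']
      push_cast; rfl
    rw [hMeq, add_mulVec, smul_mulVec, smul_mulVec, one_mulVec, dotProduct_add, dotProduct_smul,
      dotProduct_smul, e1, sum_mulVec, dotProduct_sum]
    simp only [e2, smul_eq_mul]
    push_cast; rfl
  rw [h1] at h0
  have h0' : (0 : ℝ) ≤ (2 * N - (4 * n : ℕ)) * ∑ i, ‖c i‖ ^ 2 +
        2 * ∑ j, ‖∑ i, c i * v i (ξ j)‖ ^ 2 := by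
    simpa only [RCLike.re_to_complex, Complex.ofReal_re] using h0
  have hS : 0 ≤ ∑ i, ‖c i‖ ^ 2 := Finset.sum_nonneg fun i _ => by positivity
  have hNn' : (N : ℝ) ≤ n := by exact_mod_cast hNn
  push_cast at h0'
  nlinarith

/-- Every finite family of continuous functions is, up to null sets, spanned by an `L₂`-orthonormal
family of continuous functions of at most the same size. -/
lemma exists_orthonormal_toLp_spanning {α : Type*} [TopologicalSpace α] [CompactSpace α]
    [MeasurableSpace α] [BorelSpace α] (μ : Measure α) [IsFiniteMeasure μ] {n : ℕ}
    (u : Fin n → C(α, ℂ)) :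
    ∃ N ≤ n, ∃ e : Fin N → C(α, ℂ),
      Orthonormal ℂ (fun i => ContinuousMap.toLp (E := ℂ) 2 μ ℂ (e i)) ∧
      ∀ i, ∃ a : Fin N → ℂ, ContinuousMap.toLp (E := ℂ) 2 μ ℂ (u i) =
        ContinuousMap.toLp (E := ℂ) 2 μ ℂ (∑ k, a k • e k) := by
  set T := ContinuousMap.toLp (E := ℂ) 2 μ ℂ with hT
  let V : Submodule ℂ (Lp ℂ 2 μ) := Submodule.span ℂ (Set.range fun i => T (u i))
  have : FiniteDimensional ℂ V := FiniteDimensional.span_of_finite ℂ (Set.finite_range _)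
  let b := stdOrthonormalBasis ℂ V
  have hVle : V ≤ LinearMap.range T.toLinearMap :=
    Submodule.span_le.2 (by rintro _ ⟨i, rfl⟩; exact ⟨u i, rfl⟩)
  choose e he using fun i => hVle (b i).2
  have he' : ∀ i, T (e i) = (b i : Lp ℂ 2 μ) := he
  refine ⟨Module.finrank ℂ V, (finrank_range_le_card _).trans_eq (Fintype.card_fin n), e, ?_,
    fun i => ?_⟩
  · rw [show (fun i => T (e i)) = fun i => (b i : Lp ℂ 2 μ) from funext he']
    exact b.orthonormal.comp_linearIsometry V.subtypeₗᵢ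
  · let x : V := ⟨T (u i), Submodule.subset_span ⟨i, rfl⟩⟩
    refine ⟨b.repr x, ?_⟩
    have h : ((∑ k, b.repr x k • b k : V) : Lp ℂ 2 μ) = T (u i) :=
      congrArg Subtype.val (b.sum_repr x)
    rw [← h, map_sum, Submodule.coe_sum]
    refine Finset.sum_congr rfl fun k _ => ?_
    rw [map_smul, he', Submodule.coe_smul]

/-- Least squares: a linear map bounded below has a left inverse which is stable with respect to
perturbations of the data. -/
lemma LinearMap.exists_stable_leftInverse {E G : Type*} [NormedAddCommGroup E]
    [NormedSpace ℂ E] [FiniteDimensional ℂ E] [NormedAddCommGroup G] [InnerProductSpace ℂ G]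
    (T : E →ₗ[ℂ] G) {κ : ℝ} (hκ : 0 < κ) (hT : ∀ x, κ * ‖x‖ ≤ ‖T x‖) :
    ∃ L : G →ₗ[ℂ] E, ∀ x y, κ * ‖x - L y‖ ≤ ‖T x - y‖ := by
  have hinj : Function.Injective T := by
    rw [injective_iff_map_eq_zero]
    intro x hx
    have := hT x
    rw [hx, norm_zero] at this
    exact norm_le_zero_iff.1 (by nlinarith [norm_nonneg x])
  let K := LinearMap.range T
  refine ⟨(LinearEquiv.ofInjective T hinj).symm.toLinearMap ∘ₗ
    K.orthogonalProjectionOnto.toLinearMap, fun x y => ?_⟩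
  refine (hT _).trans ?_
  have h1 : T ((LinearEquiv.ofInjective T hinj).symm (K.orthogonalProjectionOnto y)) =
      K.starProjection y := by
    have := congrArg Subtype.val
      ((LinearEquiv.ofInjective T hinj).apply_symm_apply (K.orthogonalProjectionOnto y))
    exact this
  have h2 : K.starProjection (T x) = T x :=
    Submodule.starProjection_eq_self_iff.2 (LinearMap.mem_range_self T x)
  calc ‖T (x - _)‖ = ‖K.starProjection (T x - y)‖ := by
        rw [map_sub, map_sub, h2]
        exact congrArg (fun z => ‖T x - z‖) h1
    _ ≤ _ := K.norm_starProjection_apply_le _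
  
lemma lpNormE_two_eq {α : Type*} [MeasurableSpace α] (μ : Measure α) (f : α → ℂ) :
    lpNormE μ 2 f = eLpNorm f 2 μ := by
  rw [eLpNorm_eq_lintegral_rpow_enorm_toReal (by norm_num) (by norm_num)]
  simp [lpNormE, enorm_eq_nnnorm]

lemma norm_le_of_supNormE_ne_top {α : Type*} {f : α → ℂ} (h : supNormE f ≠ ∞) (x : α) :
    ‖f x‖ ≤ (supNormE f).toReal := by
  have h1 : (‖f x‖₊ : ℝ≥0∞) ≤ supNormE f := le_iSup (fun x => (‖f x‖₊ : ℝ≥0∞)) x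
  exact ENNReal.toReal_mono h h1

/-- Linear recovery from `4 n` samples whose `L₂` error is at most three times the uniform error of
approximation from the span of `n` given functions. -/
lemma exists_recovery_le_three_mul_supNormE {α : Type*} [TopologicalSpace α] [CompactSpace α]
    [MeasurableSpace α] [BorelSpace α] (μ : Measure α) [IsProbabilityMeasure μ] {n : ℕ}
    (u : Fin n → C(α, ℂ)) :
    ∃ (ξ : Fin (4 * n) → α) (Φ : (Fin (4 * n) → ℂ) →ₗ[ℂ] C(α, ℂ)),
      ∀ (f : C(α, ℂ)) (c : Fin n → ℂ),
        lpNormE μ 2 (fun x => f x - Φ (fun j => f (ξ j)) x) ≤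
          ENNReal.ofReal 3 * supNormE (fun x => f x - ∑ i, c i * u i x) := by
  obtain ⟨N, hN, e, he, hspan⟩ := exists_orthonormal_toLp_spanning μ u
  set T := ContinuousMap.toLp (E := ℂ) 2 μ ℂ with hT
  have hTnorm : ∀ g : C(α, ℂ), ‖T g‖ = (eLpNorm g 2 μ).toReal := fun g => by
    rw [Lp.norm_def, eLpNorm_congr_ae (ContinuousMap.coeFn_toLp μ g)]
  have hmem : ∀ g : C(α, ℂ), MemLp g 2 μ := fun g =>
    (memLp_congr_ae (ContinuousMap.coeFn_toLp (p := 2) (𝕜 := ℂ) μ g)).1 (Lp.memLp _)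
  have hTe : ∀ c : Fin N → ℂ, ‖T (∑ i, c i • e i)‖ ^ 2 = ∑ i, ‖c i‖ ^ 2 := fun c => by
    rw [map_sum]
    simp only [map_smul]
    rw [← inner_self_eq_norm_sq (𝕜 := ℂ), he.inner_sum, map_sum]
    refine Finset.sum_congr rfl fun i _ => ?_
    rw [Complex.conj_mul']
    rw [← Complex.ofReal_pow, RCLike.re_to_complex, Complex.ofReal_re]
  have hint : ∀ c : Fin N → ℂ, Integrable (fun x => ‖∑ i, c i * e i x‖ ^ 2) μ := fun c => by
    have := (hmem (∑ i, c i • e i)).integrable_norm_pow (by norm_num)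
    simpa using this
  have hnorm : ∀ c : Fin N → ℂ, ∫ x, ‖∑ i, c i * e i x‖ ^ 2 ∂μ = ∑ i, ‖c i‖ ^ 2 := fun c => by
    rw [← hTe, hTnorm, (hmem _).eLpNorm_eq_integral_rpow_norm (by norm_num) (by norm_num),
      ENNReal.toReal_ofReal (by positivity)]
    rw [← Real.rpow_natCast, ← Real.rpow_mul (by positivity)]
    simp
  have hcoord : ∀ i : Fin n, ∃ a : Fin N → ℂ, ⇑(u i) =ᵐ[μ] ⇑(∑ k, a k • e k) := fun i => by
    obtain ⟨a, ha⟩ := hspan i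
    refine ⟨a, ?_⟩
    have h1 := ContinuousMap.coeFn_toLp (p := 2) (𝕜 := ℂ) μ (u i)
    rw [← hT, ha] at h1
    exact h1.symm.trans (ContinuousMap.coeFn_toLp (p := 2) (𝕜 := ℂ) μ _)
  choose a ha using hcoord
  have hae : ∀ᵐ x ∂μ, ∀ i, u i x = (∑ k, a i k • e k) x := ae_all_iff.2 ha
  obtain ⟨ξ, hξ, hdisc⟩ := exists_points_le_sum_norm_sq hN hint hnorm (ae_iff.1 hae)
  have hξ' : ∀ j i, u i (ξ j) = (∑ k, a i k • e k) (ξ j) := fun j => by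
    simpa using hξ j
  let S : EuclideanSpace ℂ (Fin N) →ₗ[ℂ] EuclideanSpace ℂ (Fin (4 * n)) :=
    { toFun := fun c => WithLp.toLp 2 fun j => ∑ i, c i * e i (ξ j)
      map_add' := fun c d => by
        ext j; simp [add_mul, Finset.sum_add_distrib]
      map_smul' := fun r c => by
        ext j; simp [Finset.mul_sum, mul_assoc] }
  let R : EuclideanSpace ℂ (Fin N) →ₗ[ℂ] C(α, ℂ) :=
    { toFun := fun c => ∑ i, c i • e i
      map_add' := fun c d => by simp [add_smul, Finset.sum_add_distrib]
      map_smul' := fun r c => by simp [Finset.smul_sum, mul_smul] }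
  obtain ⟨L, hL⟩ : ∃ L : EuclideanSpace ℂ (Fin (4 * n)) →ₗ[ℂ] EuclideanSpace ℂ (Fin N),
      ∀ x y, √n * ‖x - L y‖ ≤ ‖S x - y‖ := by
    rcases Nat.eq_zero_or_pos n with rfl | hn
    · exact ⟨0, fun x y => by simp⟩
    · refine S.exists_stable_leftInverse (by positivity) fun c => ?_
      refine abs_le_of_sq_le_sq' ?_ (norm_nonneg _) |>.2
      rw [mul_pow, Real.sq_sqrt (by positivity), EuclideanSpace.norm_sq_eq,
        EuclideanSpace.norm_sq_eq]
      exact hdisc c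
  refine ⟨ξ, R ∘ₗ L ∘ₗ (WithLp.linearEquiv 2 ℂ (Fin (4 * n) → ℂ)).symm.toLinearMap,
    fun f c => ?_⟩
  by_cases htop : supNormE (fun x => f x - ∑ i, c i * u i x) = ∞
  · rw [htop, ENNReal.mul_top (by simp)]; exact le_top
  set D := (supNormE (fun x => f x - ∑ i, c i * u i x)).toReal with hD
  have hDle : ∀ x, ‖f x - ∑ i, c i * u i x‖ ≤ D := norm_le_of_supNormE_ne_top htop
  have hD0 : 0 ≤ D := ENNReal.toReal_nonneg
  set y : EuclideanSpace ℂ (Fin (4 * n)) := WithLp.toLp 2 fun j => f (ξ j) with hy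
  set q : EuclideanSpace ℂ (Fin N) := WithLp.toLp 2 fun k => ∑ i, c i * a i k with hq
  have hqx : ∀ x, (∀ i, u i x = (∑ k, a i k • e k) x) →
      ∑ i, c i * u i x = ∑ k, q k * e k x := fun x hx => by
    simp only [hx, hq, ContinuousMap.sum_apply, ContinuousMap.smul_apply, smul_eq_mul,
      Finset.mul_sum, Finset.sum_mul]
    rw [Finset.sum_comm]
    simp only [mul_assoc]
  have hfirst : ‖T (f - R q)‖ ≤ D := by
    rw [hTnorm]
    refine ENNReal.toReal_le_of_le_ofReal hD0 ?_
    refine (eLpNorm_le_of_ae_bound (C := D) ?_).trans (by simp)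
    filter_upwards [hae] with x hx
    have : (R q) x = ∑ k, q k * e k x := by simp [R]
    rw [ContinuousMap.sub_apply, this, ← hqx x hx]
    exact hDle x
  have hsecond : ‖T (R (q - L y))‖ ≤ 2 * D := by
    have h1 : ‖T (R (q - L y))‖ = ‖q - L y‖ := by
      rw [← sq_eq_sq₀ (norm_nonneg _) (norm_nonneg _), EuclideanSpace.norm_sq_eq]
      exact hTe _
    have h2 : ‖S q - y‖ ≤ 2 * √n * D := by
      refine abs_le_of_sq_le_sq' ?_ (by positivity) |>.2
      rw [EuclideanSpace.norm_sq_eq, mul_pow, mul_pow, Real.sq_sqrt (by positivity)]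
      calc ∑ j, ‖(S q - y) j‖ ^ 2 ≤ ∑ _j : Fin (4 * n), D ^ 2 := by
            refine Finset.sum_le_sum fun j _ => ?_
            gcongr
            have : (S q - y) j = ∑ k, q k * e k (ξ j) - f (ξ j) := rfl
            rw [this, ← hqx _ (hξ' j), norm_sub_rev]
            exact hDle _
        _ = 2 ^ 2 * n * D ^ 2 := by
            rw [Finset.sum_const, Finset.card_univ, Fintype.card_fin, nsmul_eq_mul]
            push_cast; ring
    rw [h1]
    rcases Nat.eq_zero_or_pos n with rfl | hn
    · obtain rfl : N = 0 := by omega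
      rw [Subsingleton.elim (q - L y) 0, norm_zero]; positivity
    · have h3 := (hL q y).trans h2
      have : 0 < √(n : ℝ) := by positivity
      refine le_of_mul_le_mul_left (h3.trans_eq ?_) this
      ring
  have htotal : ‖T (f - R (L y))‖ ≤ 3 * D := by
    have : f - R (L y) = (f - R q) + R (q - L y) := by rw [map_sub]; abel
    rw [this, map_add]
    exact (norm_add_le _ _).trans (by linarith)
  rw [lpNormE_two_eq]
  change eLpNorm (⇑(f - R (L y))) 2 μ ≤ _
  rw [hTnorm] at htotal
  rw [← ENNReal.ofReal_toReal htop, ← ENNReal.ofReal_mul (by norm_num)]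
  exact (ENNReal.le_ofReal_iff_toReal_le (hmem (f - R (L y))).eLpNorm_ne_top (by positivity)).2 htotal

/-- **Theorem 1.1.** There exist two positive absolute constants `b` and `B` such that for any
compact `Ω ⊆ ℝ^d` with a probability measure `μ` and any compact subset `F` of `C(Ω)`,
`ϱ_{⌈bn⌉}(F, L_2) ≤ B ⬝ d_n(F, L_∞)` for every `n`. -/
theorem optimal_recovery_le_kolmogorov_width_uniform :
    ∃ b B : ℝ, 0 < b ∧ 0 < B ∧
      ∀ (d : ℕ) (Ω : Set (Fin d → ℝ)), IsCompact Ω →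
        ∀ μ : Measure Ω, IsProbabilityMeasure μ →
          ∀ F : Set C(Ω, ℂ), IsCompact F →
            ∀ n : ℕ,
              recovE μ 2 F ⌈b * n⌉₊ ≤ ENNReal.ofReal B * kolmWidthInfE F n := by
  refine ⟨4, 3, by norm_num, by norm_num, fun d Ω hΩ μ hμ F _ n => ?_⟩
  have : CompactSpace Ω := isCompact_iff_compactSpace.1 hΩ
  have hm : ⌈(4 : ℝ) * n⌉₊ = 4 * n := by
    rw [← Nat.cast_ofNat, ← Nat.cast_mul, Nat.ceil_natCast]
  have h3 : ENNReal.ofReal 3 ≠ 0 := by simp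
  rw [hm, kolmWidthInfE, ENNReal.mul_iInf_of_ne h3 ENNReal.ofReal_ne_top]
  refine le_iInf fun u => ?_
  obtain ⟨ξ, Φ, h⟩ := exists_recovery_le_three_mul_supNormE μ u
  refine (iInf₂_le ξ Φ).trans (iSup_le fun f => ?_)
  refine le_trans ?_ (mul_le_mul_right (le_iSup _ f) _)
  rw [ENNReal.mul_iInf_of_ne h3 ENNReal.ofReal_ne_top]
  exact le_iInf fun c => h f c

end
end

section
/- Let d ∈ ℕ, let Ω be a compact subset of ℝ^d equipped with a probability measure μ, let 1 ≤ p ≤ 2, and let F be a compact subset of C(Ω). Then with the same positive absolute constants b and B as in the L_2 case, for every n ∈ ℕ, ϱ_{⌈bn⌉}(F, L_p) ≤ B · d_n(F, L_∞). (This follows from the L_2 result since ‖·‖_p ≤ ‖·‖_2 for p ≤ 2 when μ is a probability measure.) -/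
open MeasureTheory ENNReal

noncomputable section

open scoped ComplexOrder

open Matrix in
/-- The trace of the Sherman–Morrison formula for a rank one update of a diagonal matrix. -/
theorem trace_inv_diagonal_add_vecMulVec {κ : Type*} [Fintype κ] [DecidableEq κ] (d : κ → ℝ)
    (hd : ∀ i, 0 < d i) (w : κ → ℂ) :
    (diagonal (fun i => (d i : ℂ)) + (2 : ℂ) • vecMulVec w (star w))⁻¹.trace =
      ((∑ i, (d i)⁻¹ - 2 * (∑ i, ((d i)⁻¹) ^ 2 * ‖w i‖ ^ 2) /
        (1 + 2 * ∑ i, (d i)⁻¹ * ‖w i‖ ^ 2) : ℝ) : ℂ) := by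
  set q : ℝ := ∑ i, (d i)⁻¹ * ‖w i‖ ^ 2 with hq
  have hq0 : 0 ≤ q := Finset.sum_nonneg fun i _ => by have := hd i; positivity
  have hqC : ∑ i, star (w i) * ((d i : ℂ)⁻¹ * w i) = (q : ℂ) := by
    rw [hq]; push_cast
    refine Finset.sum_congr rfl fun i _ => ?_
    rw [← Complex.conj_mul']; simp only [RCLike.star_def]; ring
  have hden : (1 + 2 * (q : ℂ)) ≠ 0 := by
    have : (1 + 2 * q) ≠ 0 := by positivity
    exact_mod_cast this
  have hinv : (diagonal (fun i => (d i : ℂ)) + (2 : ℂ) • vecMulVec w (star w))⁻¹ =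
      diagonal (fun i => (d i : ℂ)⁻¹) - (2 / (1 + 2 * (q : ℂ))) •
        vecMulVec (fun i => (d i : ℂ)⁻¹ * w i) (fun i => (d i : ℂ)⁻¹ * star (w i)) := by
    refine Matrix.inv_eq_right_inv ?_
    ext i j
    have hdi : (d i : ℂ) ≠ 0 := by exact_mod_cast (hd i).ne'
    have hsum : ∑ k, w i * star (w k) * ((d k : ℂ)⁻¹ * w k * ((d j : ℂ)⁻¹ * star (w j))) =
        w i * ((d j : ℂ)⁻¹ * star (w j)) * q := by
      rw [← hqC, Finset.mul_sum]
      exact Finset.sum_congr rfl fun k _ => by ring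
    rw [add_mul, mul_sub, mul_sub, diagonal_mul_diagonal]
    simp only [Matrix.mul_smul, Matrix.smul_mul, Matrix.add_apply, Matrix.sub_apply,
      Matrix.smul_apply, diagonal_mul, mul_diagonal, vecMulVec_apply, Pi.star_apply, smul_eq_mul]
    rw [Matrix.mul_apply]
    simp only [vecMulVec_apply, Pi.star_apply]
    rw [hsum]
    by_cases hij : i = j
    · subst hij
      simp only [diagonal_apply_eq, Matrix.one_apply_eq, mul_inv_cancel₀ hdi]
      field_simp
      ring
    · simp only [diagonal_apply_ne _ hij, Matrix.one_apply_ne hij]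
      field_simp
      ring
  rw [hinv, trace_sub, trace_smul, trace_diagonal, Matrix.trace]
  simp only [diag_apply, vecMulVec_apply, smul_eq_mul]
  push_cast
  congr 1
  rw [mul_div_right_comm]
  congr 1
  refine Finset.sum_congr rfl fun i _ => ?_
  rw [← Complex.conj_mul']; simp only [RCLike.star_def]; ring

/-- The barrier inequality of the one-sided sparsification step. -/
theorem barrier_inequality {κ : Type*} [Fintype κ] (d : κ → ℝ)
    (hd : ∀ i, 0 < d i) (h : ∑ i, (d i + 1)⁻¹ ≤ 1 / 2) :
    (∑ i, (d i)⁻¹ - ∑ i, (d i + 1)⁻¹) * (1 / 2 + ∑ i, (d i)⁻¹) ≤ ∑ i, ((d i)⁻¹) ^ 2 := by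
  set R := ∑ i, (d i + 1)⁻¹ with hR
  set S := ∑ i, (d i)⁻¹ with hS
  have hD : S - R = ∑ i, (d i)⁻¹ * (d i + 1)⁻¹ := by
    rw [hS, hR, ← Finset.sum_sub_distrib]
    refine Finset.sum_congr rfl fun i _ => ?_
    have := hd i
    field_simp
    ring
  have hD0 : 0 ≤ S - R := by
    rw [hD]; exact Finset.sum_nonneg fun i _ => by have := hd i; positivity
  have hT : ∑ i, ((d i)⁻¹) ^ 2 = (S - R) + ∑ i, ((d i)⁻¹) ^ 2 * (d i + 1)⁻¹ := by
    rw [hD, ← Finset.sum_add_distrib]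
    refine Finset.sum_congr rfl fun i _ => ?_
    have := hd i
    field_simp
  have hT0 : 0 ≤ ∑ i, ((d i)⁻¹) ^ 2 * (d i + 1)⁻¹ :=
    Finset.sum_nonneg fun i _ => by have := hd i; positivity
  have hCS : (S - R) ^ 2 ≤ (∑ i, ((d i)⁻¹) ^ 2 * (d i + 1)⁻¹) * R := by
    rw [hD]
    refine Finset.sum_sq_le_sum_mul_sum_of_sq_le_mul _ (fun i _ => ?_) (fun i _ => ?_)
      (fun i _ => ?_)
    · have := hd i; positivity
    · have := hd i; positivity
    · exact le_of_eq (by ring)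
  nlinarith

open Matrix in
/-- One step of the one-sided barrier argument. -/
theorem exists_barrier_step {α κ : Type*} [MeasurableSpace α] (μ : Measure α)
    [IsProbabilityMeasure μ] [Fintype κ] [DecidableEq κ] (φ : α → κ → ℂ)
    (hφint : ∀ a : κ → ℂ, Integrable (fun x => ‖∑ i, a i * φ x i‖ ^ 2) μ)
    (hφ : ∀ a : κ → ℂ, ∫ x, ‖∑ i, a i * φ x i‖ ^ 2 ∂μ = ∑ i, ‖a i‖ ^ 2)
    {Z : Set α} (hZ : μ Z = 0) {N : Matrix κ κ ℂ} (hN : N.PosDef)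
    (htr : N⁻¹.trace.re ≤ 1 / 2) :
    ∃ x ∉ Z, (N - 1 + (2 : ℂ) • vecMulVec (φ x) (star (φ x))).PosDef ∧
      (N - 1 + (2 : ℂ) • vecMulVec (φ x) (star (φ x)))⁻¹.trace.re ≤ 1 / 2 := by
  obtain ⟨U, hU⟩ : ∃ U : unitaryGroup κ ℂ, U = hN.1.eigenvectorUnitary := ⟨_, rfl⟩
  set ν := hN.1.eigenvalues with hν
  have hν0 : ∀ i, 0 < ν i := hN.eigenvalues_pos
  have hUU : (U : Matrix κ κ ℂ) * (U : Matrix κ κ ℂ)ᴴ = 1 := Unitary.coe_mul_star_self U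
  have hUU' : (U : Matrix κ κ ℂ)ᴴ * (U : Matrix κ κ ℂ) = 1 := Unitary.coe_star_mul_self U
  have hspec : N = (U : Matrix κ κ ℂ) * diagonal (fun i => (ν i : ℂ)) * (U : Matrix κ κ ℂ)ᴴ := by
    conv_lhs => rw [hN.1.spectral_theorem]
    rw [Unitary.conjStarAlgAut_apply, hU]
    rfl
  have hconj : ∀ K : Matrix κ κ ℂ, IsUnit K.det →
      ((U : Matrix κ κ ℂ) * K * (U : Matrix κ κ ℂ)ᴴ)⁻¹.trace = K⁻¹.trace := by
    intro K hK
    have : ((U : Matrix κ κ ℂ) * K * (U : Matrix κ κ ℂ)ᴴ)⁻¹ =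
        (U : Matrix κ κ ℂ) * K⁻¹ * (U : Matrix κ κ ℂ)ᴴ := by
      refine Matrix.inv_eq_right_inv ?_
      calc _ = (U : Matrix κ κ ℂ) * (K * (((U : Matrix κ κ ℂ)ᴴ * (U : Matrix κ κ ℂ)) * K⁻¹)) *
            (U : Matrix κ κ ℂ)ᴴ := by simp only [Matrix.mul_assoc]
        _ = 1 := by rw [hUU', Matrix.one_mul, Matrix.mul_nonsing_inv _ hK, Matrix.mul_one, hUU]
    rw [this, Matrix.trace_mul_comm, ← Matrix.mul_assoc, hUU', Matrix.one_mul]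
  have hsum : ∑ i, (ν i)⁻¹ ≤ 1 / 2 := by
    have hpd : (diagonal (fun i => (ν i : ℂ))).PosDef :=
      posDef_diagonal_iff.2 fun i => by exact_mod_cast hν0 i
    have h1 := hconj _ ((Matrix.isUnit_iff_isUnit_det _).1 hpd.isUnit)
    have h2 : (diagonal (fun i => (ν i : ℂ)))⁻¹ = diagonal (fun i => ((ν i)⁻¹ : ℂ)) := by
      refine Matrix.inv_eq_right_inv ?_
      rw [diagonal_mul_diagonal, ← diagonal_one]
      congr 1
      ext i
      exact mul_inv_cancel₀ (by exact_mod_cast (hν0 i).ne')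
    rw [← hspec, h2, trace_diagonal] at h1
    rw [h1] at htr
    have : (∑ i, ((ν i : ℂ))⁻¹) = ((∑ i, (ν i)⁻¹ : ℝ) : ℂ) := by push_cast; rfl
    rwa [this, Complex.ofReal_re] at htr
  have hν2 : ∀ i, 0 < ν i - 1 := by
    intro i
    have h1 : (ν i)⁻¹ ≤ 1 / 2 := (Finset.single_le_sum
      (fun j _ => (inv_pos.2 (hν0 j)).le) (Finset.mem_univ i)).trans hsum
    have h2 : (ν i)⁻¹ * ν i = 1 := inv_mul_cancel₀ (hν0 i).ne'
    nlinarith [hν0 i]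
  set d : κ → ℝ := fun i => ν i - 1 with hd
  have hN1 : N - 1 = (U : Matrix κ κ ℂ) * diagonal (fun i => (d i : ℂ)) *
      (U : Matrix κ κ ℂ)ᴴ := by
    have : diagonal (fun i => (d i : ℂ)) = diagonal (fun i => (ν i : ℂ)) - 1 := by
      rw [← diagonal_one, diagonal_sub]
      congr 1; ext i; simp [hd]
    rw [this, Matrix.mul_sub, Matrix.sub_mul, ← hspec, Matrix.mul_one, hUU]
  have hbar := barrier_inequality d hν2 (by simpa [hd] using hsum)
  set w : α → κ → ℂ := fun x i => ∑ j, star ((U : Matrix κ κ ℂ) j i) * φ x j with hw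
  have hwint : ∀ i, Integrable (fun x => ‖w x i‖ ^ 2) μ := fun i => hφint _
  have hw1 : ∀ i, ∫ x, ‖w x i‖ ^ 2 ∂μ = 1 := by
    intro i
    rw [hφ (fun j => star ((U : Matrix κ κ ℂ) j i))]
    have := congrFun (congrFun hUU' i) i
    rw [Matrix.mul_apply, Matrix.one_apply_eq] at this
    have h2 : ((∑ j, ‖star ((U : Matrix κ κ ℂ) j i)‖ ^ 2 : ℝ) : ℂ) = 1 := by
      rw [← this]; push_cast
      refine Finset.sum_congr rfl fun j _ => ?_
      rw [norm_star, ← Complex.conj_mul']; rfl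
    exact_mod_cast h2
  set D := ∑ i, (d i)⁻¹ - ∑ i, (d i + 1)⁻¹ with hDdef
  have hi2 : Integrable (fun x => ∑ i, ((d i)⁻¹) ^ 2 * ‖w x i‖ ^ 2) μ :=
    integrable_finsetSum _ fun i _ => (hwint i).const_mul _
  have hi1 : Integrable (fun x => ∑ i, (d i)⁻¹ * ‖w x i‖ ^ 2) μ :=
    integrable_finsetSum _ fun i _ => (hwint i).const_mul _
  have hi0 : Integrable (fun x => D * (1 / 2 + ∑ i, (d i)⁻¹ * ‖w x i‖ ^ 2)) μ :=
    ((integrable_const _).add hi1).const_mul _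
  obtain ⟨x, hxZ, hx⟩ := exists_notMem_null_integral_le (hi2.sub hi0) hZ
  have hI : ∫ x, (∑ i, ((d i)⁻¹) ^ 2 * ‖w x i‖ ^ 2 -
      D * (1 / 2 + ∑ i, (d i)⁻¹ * ‖w x i‖ ^ 2)) ∂μ =
      ∑ i, ((d i)⁻¹) ^ 2 - D * (1 / 2 + ∑ i, (d i)⁻¹) := by
    rw [integral_sub hi2 hi0, integral_const_mul, integral_add (integrable_const _) hi1,
      integral_finsetSum _ fun i _ => (hwint i).const_mul _,
      integral_finsetSum _ fun i _ => (hwint i).const_mul _]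
    simp [integral_const_mul, hw1]
  simp only [Pi.sub_apply] at hx
  rw [hI] at hx
  refine ⟨x, hxZ, ?_, ?_⟩
  all_goals
    have hpsd : ∀ v : κ → ℂ, ((2 : ℂ) • vecMulVec v (star v)).PosSemidef := fun v =>
      (posSemidef_vecMulVec_self_star v).smul (by norm_num)
    have hdpd : (diagonal (fun i => (d i : ℂ))).PosDef :=
      posDef_diagonal_iff.2 fun i => by exact_mod_cast hν2 i
  · refine PosDef.add_posSemidef ?_ (hpsd _)
    rw [hN1]
    refine hdpd.mul_mul_conjTranspose_same ?_
    exact Matrix.vecMul_injective_of_isUnit ⟨⟨_, _, hUU, hUU'⟩, rfl⟩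
  · have hKpd := hdpd.add_posSemidef (hpsd (w x))
    have hKeq : N - 1 + (2 : ℂ) • vecMulVec (φ x) (star (φ x)) = (U : Matrix κ κ ℂ) *
        (diagonal (fun i => (d i : ℂ)) + (2 : ℂ) • vecMulVec (w x) (star (w x))) *
        (U : Matrix κ κ ℂ)ᴴ := by
      have hwx : w x = (U : Matrix κ κ ℂ)ᴴ *ᵥ φ x := rfl
      rw [Matrix.mul_add, Matrix.add_mul, ← hN1, hwx, Matrix.mul_smul, Matrix.smul_mul,
        mul_vecMulVec, vecMulVec_mul, star_mulVec, conjTranspose_conjTranspose,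
        mulVec_mulVec, vecMul_vecMul, hUU, one_mulVec, vecMul_one]
    rw [hKeq, hconj _ ((Matrix.isUnit_iff_isUnit_det _).1 hKpd.isUnit),
      trace_inv_diagonal_add_vecMulVec d hν2, Complex.ofReal_re]
    have hq0 : 0 ≤ ∑ i, (d i)⁻¹ * ‖w x i‖ ^ 2 :=
      Finset.sum_nonneg fun i _ => by have := hν2 i; positivity
    have hDle : D ≤ 2 * (∑ i, ((d i)⁻¹) ^ 2 * ‖w x i‖ ^ 2) /
        (1 + 2 * ∑ i, (d i)⁻¹ * ‖w x i‖ ^ 2) := by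
      rw [le_div_iff₀ (by positivity)]
      linarith
    have : ∑ i, (d i + 1)⁻¹ ≤ 1 / 2 := by simpa [hd] using hsum
    linarith

open Matrix in
/-- Equal weight one-sided discretization of an orthonormal system. -/
theorem exists_points_frame_lower_bound {α κ : Type*} [MeasurableSpace α] (μ : Measure α)
    [IsProbabilityMeasure μ] [Fintype κ] [DecidableEq κ] (φ : α → κ → ℂ)
    (hφint : ∀ a : κ → ℂ, Integrable (fun x => ‖∑ i, a i * φ x i‖ ^ 2) μ)
    (hφ : ∀ a : κ → ℂ, ∫ x, ‖∑ i, a i * φ x i‖ ^ 2 ∂μ = ∑ i, ‖a i‖ ^ 2)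
    {Z : Set α} (hZ : μ Z = 0) {n : ℕ} (hn : 0 < n) (hκ : Fintype.card κ ≤ n) :
    ∃ ξ : Fin (4 * n) → α, (∀ j, ξ j ∉ Z) ∧ ∀ a : κ → ℂ,
      n * ∑ i, ‖a i‖ ^ 2 ≤ ∑ j, ‖∑ i, a i * φ (ξ j) i‖ ^ 2 := by
  have hn' : (0 : ℝ) < n := by exact_mod_cast hn
  have key : ∀ m : ℕ, ∃ ξ : Fin m → α, (∀ j, ξ j ∉ Z) ∧
      ((2 * n - m : ℂ) • (1 : Matrix κ κ ℂ) +
        ∑ j, (2 : ℂ) • vecMulVec (φ (ξ j)) (star (φ (ξ j)))).PosDef ∧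
      ((2 * n - m : ℂ) • (1 : Matrix κ κ ℂ) +
        ∑ j, (2 : ℂ) • vecMulVec (φ (ξ j)) (star (φ (ξ j))))⁻¹.trace.re ≤ 1 / 2 := by
    intro m
    induction m with
    | zero =>
      refine ⟨Fin.elim0, fun j => j.elim0, ?_, ?_⟩
      · simp only [Nat.cast_zero, sub_zero, Finset.univ_eq_empty, Finset.sum_empty, add_zero]
        exact PosDef.one.smul (by exact_mod_cast (by positivity : (0 : ℝ) < 2 * n))
      · have : ((2 * n : ℂ) • (1 : Matrix κ κ ℂ))⁻¹ = ((2 * n : ℂ)⁻¹) • (1 : Matrix κ κ ℂ) := by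
          refine Matrix.inv_eq_right_inv ?_
          rw [Matrix.smul_mul, Matrix.one_mul, smul_smul, mul_inv_cancel₀, one_smul]
          exact_mod_cast (by positivity : (2 * n : ℝ) ≠ 0)
        simp only [Nat.cast_zero, sub_zero, Finset.univ_eq_empty, Finset.sum_empty, add_zero,
          this, trace_smul, trace_one, smul_eq_mul]
        have h2 : ((2 * n : ℂ)⁻¹ * (Fintype.card κ : ℂ)) =
            (((2 * n : ℝ)⁻¹ * (Fintype.card κ : ℝ) : ℝ) : ℂ) := by push_cast; rfl
        rw [h2, Complex.ofReal_re, inv_mul_le_iff₀ (by positivity)]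
        have : (Fintype.card κ : ℝ) ≤ n := by exact_mod_cast hκ
        linarith
    | succ m ih =>
      obtain ⟨ξ, hξ, hpd, htr⟩ := ih
      obtain ⟨x, hx, h1, h2⟩ := exists_barrier_step μ φ hφint hφ hZ hpd htr
      have e : (2 * n - (m + 1 : ℕ) : ℂ) • (1 : Matrix κ κ ℂ) +
          ∑ j, (2 : ℂ) • vecMulVec (φ (Fin.snoc (α := fun _ => α) ξ x j))
            (star (φ (Fin.snoc (α := fun _ => α) ξ x j))) =
          ((2 * n - m : ℂ) • (1 : Matrix κ κ ℂ) +
            ∑ j, (2 : ℂ) • vecMulVec (φ (ξ j)) (star (φ (ξ j)))) - 1 +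
            (2 : ℂ) • vecMulVec (φ x) (star (φ x)) := by
        rw [Fin.sum_univ_castSucc]
        simp only [Fin.snoc_castSucc, Fin.snoc_last]
        push_cast
        rw [← sub_sub, sub_smul _ (1 : ℂ), one_smul]
        abel
      refine ⟨Fin.snoc (α := fun _ => α) ξ x, ?_, ?_, ?_⟩
      · intro j
        refine Fin.lastCases ?_ (fun i => ?_) j
        · simpa using hx
        · simpa using hξ i
      · rw [e]; exact h1
      · rw [e]; exact h2
  obtain ⟨ξ, hξ, hpd, -⟩ := key (4 * n)
  refine ⟨ξ, hξ, fun a => ?_⟩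
  have h := hpd.posSemidef.dotProduct_mulVec_nonneg (star a)
  have hre := (Complex.le_def.1 h).1
  have e1 : star (star a) ⬝ᵥ (((2 * n - (4 * n : ℕ) : ℂ) • (1 : Matrix κ κ ℂ) +
        ∑ j, (2 : ℂ) • vecMulVec (φ (ξ j)) (star (φ (ξ j)))) *ᵥ star a) =
      ((-(2 * n) * ∑ i, ‖a i‖ ^ 2 + 2 * ∑ j, ‖∑ i, a i * φ (ξ j) i‖ ^ 2 : ℝ) : ℂ) := by
    rw [star_star, add_mulVec, dotProduct_add, smul_mulVec, one_mulVec, dotProduct_smul,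
      sum_mulVec, dotProduct_sum]
    push_cast
    congr 1
    · rw [smul_eq_mul]
      congr 1
      · ring
      · simp only [dotProduct, Pi.star_apply]
        refine Finset.sum_congr rfl fun i _ => ?_
        rw [← Complex.mul_conj']; rfl
    · rw [Finset.mul_sum]
      refine Finset.sum_congr rfl fun j _ => ?_
      rw [smul_mulVec, dotProduct_smul, vecMulVec_mulVec, dotProduct_smul, smul_eq_mul,
        star_dotProduct_star, op_smul_eq_smul, smul_eq_mul, RCLike.star_def, Complex.conj_mul']
      rfl
  rw [e1, Complex.ofReal_re, Complex.zero_re] at hre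
  linarith

/-- The squared `L_2` norm as an integral. -/
theorem integral_norm_sq_Lp {α : Type*} [MeasurableSpace α] {μ : Measure α} (g : Lp ℂ 2 μ) :
    ∫ x, ‖g x‖ ^ 2 ∂μ = ‖g‖ ^ 2 := by
  have h := L2.inner_def (𝕜 := ℂ) g g
  simp only [inner_self_eq_norm_sq_to_K] at h
  have h2 : ∫ x, ((‖g x‖ : ℂ)) ^ 2 ∂μ = ((∫ x, ‖g x‖ ^ 2 ∂μ : ℝ) : ℂ) := by
    rw [← integral_complex_ofReal]; simp
  have h3 : ((‖g‖ : ℂ)) ^ 2 = ((∫ x, ‖g x‖ ^ 2 ∂μ : ℝ) : ℂ) := h.trans h2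
  exact_mod_cast h3.symm

theorem Lp_coeFn_sum_smul {α κ : Type*} [MeasurableSpace α] {μ : Measure α} [Fintype κ]
    (c : κ → ℂ) (g : κ → Lp ℂ 2 μ) :
    ⇑(∑ i, c i • g i) =ᵐ[μ] fun x => ∑ i, c i * g i x := by
  have h : ∀ᵐ x ∂μ, ∀ i, (c i • g i : Lp ℂ 2 μ) x = c i * g i x :=
    ae_all_iff.2 fun i => Lp.coeFn_smul (c i) (g i)
  filter_upwards [Lp.coeFn_finsetSum Finset.univ (fun i => c i • g i), h] with x h1 h2
  rw [h1, Finset.sum_apply]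
  exact Finset.sum_congr rfl fun i _ => h2 i

/-- One-sided `L_2` discretization, with equal weights, of an `n`-dimensional space of square
integrable functions at `4n` points. -/
theorem exists_points_discretization_L2 {α : Type*} [MeasurableSpace α] (μ : Measure α)
    [IsProbabilityMeasure μ] {n : ℕ} (u : Fin n → α → ℂ) (hu : ∀ i, MemLp (u i) 2 μ) :
    ∃ ξ : Fin (4 * n) → α, ∀ c : Fin n → ℂ,
      ∫ x, ‖∑ i, c i * u i x‖ ^ 2 ∂μ ≤ (n : ℝ)⁻¹ * ∑ j, ‖∑ i, c i * u i (ξ j)‖ ^ 2 := by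
  rcases Nat.eq_zero_or_pos n with rfl | hn
  · exact ⟨fun j => j.elim0, fun c => by simp⟩
  have hn' : (0 : ℝ) < n := by exact_mod_cast hn
  set V := Submodule.span ℂ (Set.range fun i => (hu i).toLp) with hV
  have : FiniteDimensional ℂ V := FiniteDimensional.span_of_finite ℂ (Set.finite_range _)
  set b := stdOrthonormalBasis ℂ V with hb
  set v : Fin n → V := fun i => ⟨(hu i).toLp, Submodule.subset_span ⟨i, rfl⟩⟩ with hv
  have hsum : ∀ a : Fin (Module.finrank ℂ V) → ℂ,
      (∑ i, a i • (b i : Lp ℂ 2 μ)) = ((∑ i, a i • b i : V) : Lp ℂ 2 μ) := fun a => by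
    push_cast; rfl
  have hae : ∀ a : Fin (Module.finrank ℂ V) → ℂ,
      (fun x => ‖((∑ i, a i • b i : V) : Lp ℂ 2 μ) x‖ ^ 2) =ᵐ[μ]
        fun x => ‖∑ i, a i * (b i : Lp ℂ 2 μ) x‖ ^ 2 := fun a => by
    filter_upwards [Lp_coeFn_sum_smul a fun i => (b i : Lp ℂ 2 μ)] with x hx
    rw [← hsum, hx]
  have hnorm : ∀ a : Fin (Module.finrank ℂ V) → ℂ,
      ‖(∑ i, a i • b i : V)‖ ^ 2 = ∑ i, ‖a i‖ ^ 2 := fun a => by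
    have h := b.sum_repr_symm (WithLp.toLp 2 a)
    rw [h, LinearIsometryEquiv.norm_map, EuclideanSpace.norm_sq_eq]
  set C : Fin n → Fin (Module.finrank ℂ V) → ℂ := fun i j => b.repr (v i) j with hC
  have hrel : ∀ᵐ x ∂μ, ∀ i, u i x = ∑ j, C i j * (b j : Lp ℂ 2 μ) x := by
    refine ae_all_iff.2 fun i => ?_
    have h1 : (∑ j, C i j • (b j : Lp ℂ 2 μ)) = (hu i).toLp := by
      rw [hsum, b.sum_repr]
    filter_upwards [Lp_coeFn_sum_smul (C i) fun j => (b j : Lp ℂ 2 μ), (hu i).coeFn_toLp]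
      with x h2 h3
    rw [← h3, ← h1, h2]
  obtain ⟨ξ, hξ, hlow⟩ := exists_points_frame_lower_bound μ
    (fun x j => (b j : Lp ℂ 2 μ) x)
    (fun a => ((Lp.memLp ((∑ i, a i • b i : V) : Lp ℂ 2 μ)).integrable_norm_pow
      two_ne_zero).congr (hae a))
    (fun a => by rw [← integral_congr_ae (hae a), integral_norm_sq_Lp, ← Submodule.coe_norm, hnorm])
    (ae_iff.1 hrel) hn
    (by
      rw [Fintype.card_fin]
      have h := finrank_range_le_card (R := ℂ) fun i => (hu i).toLp
      rwa [Fintype.card_fin] at h)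
  refine ⟨ξ, fun c => ?_⟩
  have hcomb : ∀ x, (∀ i, u i x = ∑ j, C i j * (b j : Lp ℂ 2 μ) x) →
      ∑ i, c i * u i x = ∑ j, (∑ i, c i * C i j) * (b j : Lp ℂ 2 μ) x := fun x hx => by
    simp only [hx, Finset.mul_sum, Finset.sum_mul, mul_assoc]
    exact Finset.sum_comm
  have hL : ∫ x, ‖∑ i, c i * u i x‖ ^ 2 ∂μ = ∑ j, ‖∑ i, c i * C i j‖ ^ 2 := by
    rw [← hnorm, Submodule.coe_norm, ← integral_norm_sq_Lp]
    refine integral_congr_ae ?_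
    filter_upwards [hrel, hae fun j => ∑ i, c i * C i j] with x h1 h2
    rw [h2, hcomb x h1]
  rw [hL, le_inv_mul_iff₀ hn']
  refine (hlow _).trans_eq (Finset.sum_congr rfl fun j _ => ?_)
  rw [hcomb _ (not_not.1 (hξ j))]

/-- Linear least squares recovery from `4n` points. -/
theorem exists_points_linear_recovery {α : Type*} [TopologicalSpace α] [CompactSpace α]
    [MeasurableSpace α] [OpensMeasurableSpace α] (μ : Measure α) [IsProbabilityMeasure μ] {n : ℕ}
    (u : Fin n → C(α, ℂ)) :
    ∃ (ξ : Fin (4 * n) → α) (Φ : (Fin (4 * n) → ℂ) →ₗ[ℂ] C(α, ℂ)),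
      ∀ (f : α → ℂ) (c : Fin n → ℂ) (r : ℝ), 0 ≤ r →
        (∀ x, ‖f x - ∑ i, c i * u i x‖ ≤ r) →
        ∫ x, ‖∑ i, c i * u i x - Φ (fun j => f (ξ j)) x‖ ^ 2 ∂μ ≤ (2 * r) ^ 2 := by
  have hmem : ∀ i, MemLp (u i) 2 μ := fun i =>
    MemLp.of_bound (u i).continuous.aestronglyMeasurable ‖u i‖
      (ae_of_all _ (u i).norm_coe_le_norm)
  obtain ⟨ξ, hξ⟩ := exists_points_discretization_L2 μ (fun i => u i) hmem
  let T : (Fin n → ℂ) →ₗ[ℂ] EuclideanSpace ℂ (Fin (4 * n)) :=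
    (WithLp.linearEquiv 2 ℂ (Fin (4 * n) → ℂ)).symm.toLinearMap ∘ₗ
      LinearMap.pi fun j => ∑ i, (u i (ξ j)) • LinearMap.proj i
  have hT : ∀ c j, T c j = ∑ i, c i * u i (ξ j) := fun c j => by
    simp [T, mul_comm]
  obtain ⟨g, hg⟩ := T.rangeRestrict.exists_rightInverse_of_surjective T.range_rangeRestrict
  let P := T.range.orthogonalProjectionOnto
  let Φ : (Fin (4 * n) → ℂ) →ₗ[ℂ] C(α, ℂ) :=
    (∑ i, (LinearMap.proj i : (Fin n → ℂ) →ₗ[ℂ] ℂ).smulRight (u i)) ∘ₗ g ∘ₗ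
      P.toLinearMap ∘ₗ (WithLp.linearEquiv 2 ℂ (Fin (4 * n) → ℂ)).symm.toLinearMap
  refine ⟨ξ, Φ, fun f c r hr hf => ?_⟩
  set y : EuclideanSpace ℂ (Fin (4 * n)) := WithLp.toLp 2 fun j => f (ξ j) with hy
  set c' := g (P y) with hc'
  have hΦ : ∀ x, Φ (fun j => f (ξ j)) x = ∑ i, c' i * u i x := fun x => by
    simp [Φ, hc', hy, ContinuousMap.sum_apply]
  have hTc' : T c' = P y := congrArg Subtype.val (LinearMap.congr_fun hg (P y))
  have hPT : ((P (T c) : T.range) : EuclideanSpace ℂ (Fin (4 * n))) = T c :=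
    Submodule.starProjection_eq_self_iff.2 ⟨c, rfl⟩
  have hle : ‖T (c - c')‖ ≤ ‖T c - y‖ := by
    have : T (c - c') = (P (T c - y) : T.range) := by
      rw [map_sub T, hTc', map_sub P, Submodule.coe_sub, hPT]
    rw [this]
    exact T.range.norm_orthogonalProjectionOnto_apply_le _
  calc ∫ x, ‖∑ i, c i * u i x - Φ (fun j => f (ξ j)) x‖ ^ 2 ∂μ
      = ∫ x, ‖∑ i, (c - c') i * u i x‖ ^ 2 ∂μ := by
        simp only [hΦ, ← Finset.sum_sub_distrib, Pi.sub_apply, sub_mul]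
    _ ≤ (n : ℝ)⁻¹ * ‖T (c - c')‖ ^ 2 := by
        rw [EuclideanSpace.norm_sq_eq]
        simp only [hT]
        exact hξ _
    _ ≤ (n : ℝ)⁻¹ * ‖T c - y‖ ^ 2 := by gcongr
    _ ≤ (n : ℝ)⁻¹ * ∑ _j : Fin (4 * n), r ^ 2 := by
        rw [EuclideanSpace.norm_sq_eq]
        gcongr with j
        rw [PiLp.sub_apply, hT, norm_sub_rev]
        exact hf _
    _ ≤ (2 * r) ^ 2 := by
        rcases Nat.eq_zero_or_pos n with rfl | hn
        · simp; positivity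
        · have hn' : (0 : ℝ) < n := by exact_mod_cast hn
          simp only [Finset.sum_const, Finset.card_univ, Fintype.card_fin, nsmul_eq_mul]
          push_cast
          field_simp
          linarith

theorem lpNormE_eq_eLpNorm' {α : Type*} [MeasurableSpace α] (μ : Measure α) (p : ℝ) (f : α → ℂ) :
    lpNormE μ p f = eLpNorm' f p μ := rfl

/-- Linear recovery in `L_p`, `1 ≤ p ≤ 2`, from `4n` points with error at most three times the
Kolmogorov width in the uniform norm. -/
theorem recovE_le_three_mul_kolmWidthInfE {α : Type*} [TopologicalSpace α] [CompactSpace α]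
    [MeasurableSpace α] [OpensMeasurableSpace α] (μ : Measure α) [IsProbabilityMeasure μ]
    (F : Set C(α, ℂ)) {p : ℝ} (hp1 : 1 ≤ p) (hp2 : p ≤ 2) (n : ℕ) :
    recovE μ p F (4 * n) ≤ 3 * kolmWidthInfE F n := by
  have h3 : (3 : ℝ≥0∞) ≠ 0 := by norm_num
  have h3' : (3 : ℝ≥0∞) ≠ ∞ := by norm_num
  unfold kolmWidthInfE
  rw [ENNReal.mul_iInf_of_ne h3 h3']
  refine le_iInf fun u => ?_
  obtain ⟨ξ, Φ, hΦ⟩ := exists_points_linear_recovery μ u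
  refine (iInf₂_le ξ Φ).trans (iSup_le fun f => ?_)
  refine le_trans ?_ (mul_le_mul_right (le_iSup _ f) _)
  rw [ENNReal.mul_iInf_of_ne h3 h3']
  refine le_iInf fun c => ?_
  set s := supNormE fun x => (f : C(α, ℂ)) x - ∑ i, c i * u i x with hs
  rcases eq_or_ne s ∞ with htop | hfin
  · rw [htop, ENNReal.mul_top h3]; exact le_top
  have hpt : ∀ x, ‖(f : C(α, ℂ)) x - ∑ i, c i * u i x‖ₑ ≤ s := fun x =>
    le_iSup (fun x => ‖(f : C(α, ℂ)) x - ∑ i, c i * u i x‖ₑ) x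
  set r := s.toReal with hr
  have hsr : s = ENNReal.ofReal r := (ENNReal.ofReal_toReal hfin).symm
  have hr0 : 0 ≤ r := ENNReal.toReal_nonneg
  have hptr : ∀ x, ‖(f : C(α, ℂ)) x - ∑ i, c i * u i x‖ ≤ r := fun x => by
    have := ENNReal.toReal_mono hfin (hpt x)
    rwa [toReal_enorm] at this
  have hI := hΦ f c r hr0 hptr
  set A : C(α, ℂ) := (f : C(α, ℂ)) - ∑ i, c i • u i with hA
  set B : C(α, ℂ) := ∑ i, c i • u i - Φ fun j => (f : C(α, ℂ)) (ξ j) with hB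
  have hAx : ∀ x, A x = (f : C(α, ℂ)) x - ∑ i, c i * u i x := fun x => by
    simp [hA, ContinuousMap.sum_apply]
  have hBx : ∀ x, B x = ∑ i, c i * u i x - Φ (fun j => (f : C(α, ℂ)) (ξ j)) x := fun x => by
    simp [hB, ContinuousMap.sum_apply]
  have hAm : AEStronglyMeasurable A μ := A.continuous.aestronglyMeasurable
  have hBm : AEStronglyMeasurable B μ := B.continuous.aestronglyMeasurable
  have hAB : (fun x => (f : C(α, ℂ)) x - Φ (fun j => (f : C(α, ℂ)) (ξ j)) x) = ⇑A + ⇑B := by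
    ext x
    rw [Pi.add_apply, hAx, hBx]
    ring
  have hA2 : eLpNorm' A 2 μ ≤ s := by
    refine (eLpNorm'_le_eLpNormEssSup two_pos).trans (essSup_le_of_ae_le _ ?_)
    exact ae_of_all _ fun x => by simpa only [hAx] using hpt x
  have hB2 : eLpNorm' B 2 μ ≤ 2 * s := by
    have hBint : Integrable (fun x => ‖B x‖ ^ 2) μ :=
      (MemLp.of_bound hBm ‖B‖ (ae_of_all _ B.norm_coe_le_norm)).integrable_norm_pow
        (p := 2) two_ne_zero
    have hlint : ∫⁻ x, ‖B x‖ₑ ^ (2 : ℝ) ∂μ = ENNReal.ofReal (∫ x, ‖B x‖ ^ 2 ∂μ) := by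
      rw [ofReal_integral_eq_lintegral_ofReal hBint (ae_of_all _ fun x => by positivity)]
      refine lintegral_congr fun x => ?_
      rw [ENNReal.ofReal_pow (norm_nonneg _), ofReal_norm, ENNReal.rpow_two]
    simp only [← hBx] at hI
    calc eLpNorm' B 2 μ = (ENNReal.ofReal (∫ x, ‖B x‖ ^ 2 ∂μ)) ^ (1 / (2 : ℝ)) := by
          rw [← hlint]; rfl
      _ ≤ (ENNReal.ofReal ((2 * r) ^ 2)) ^ (1 / (2 : ℝ)) := by gcongr
      _ = 2 * s := by
          rw [ENNReal.ofReal_pow (by positivity), ← ENNReal.rpow_two, ← ENNReal.rpow_mul,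
            ENNReal.ofReal_mul zero_le_two, hsr]
          norm_num
  rw [lpNormE_eq_eLpNorm', hAB]
  calc eLpNorm' (⇑A + ⇑B) p μ ≤ eLpNorm' (⇑A + ⇑B) 2 μ :=
        eLpNorm'_le_eLpNorm'_of_exponent_le (by linarith) hp2 μ (hAm.add hBm)
    _ ≤ eLpNorm' A 2 μ + eLpNorm' B 2 μ := eLpNorm'_add_le hAm hBm one_le_two
    _ ≤ s + 2 * s := add_le_add hA2 hB2
    _ = 3 * s := by ring

/-- With the same positive absolute constants `b` and `B` as in the `L_2` recovery theorem
(`ϱ_{⌈bn⌉}(F, L_2) ≤ B ⬝ d_n(F, L_∞)`), one has, for every `1 ≤ p ≤ 2`,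
`ϱ_{⌈bn⌉}(F, L_p) ≤ B ⬝ d_n(F, L_∞)` for all compact `Ω ⊆ ℝ^d` with a probability
measure `μ` and all compact `F ⊆ C(Ω)`. -/
theorem optimal_recovery_Lp_le_kolmogorov_width_uniform :
    ∃ b B : ℝ, 0 < b ∧ 0 < B ∧
      (∀ (d : ℕ) (Ω : Set (Fin d → ℝ)), IsCompact Ω →
        ∀ μ : Measure Ω, IsProbabilityMeasure μ →
          ∀ F : Set C(Ω, ℂ), IsCompact F →
            ∀ n : ℕ,
              recovE μ 2 F ⌈b * n⌉₊ ≤ ENNReal.ofReal B * kolmWidthInfE F n) ∧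
      (∀ (d : ℕ) (Ω : Set (Fin d → ℝ)), IsCompact Ω →
        ∀ μ : Measure Ω, IsProbabilityMeasure μ →
          ∀ F : Set C(Ω, ℂ), IsCompact F →
            ∀ p : ℝ, 1 ≤ p → p ≤ 2 →
              ∀ n : ℕ,
                recovE μ p F ⌈b * n⌉₊ ≤ ENNReal.ofReal B * kolmWidthInfE F n) := by
  have key : ∀ (d : ℕ) (Ω : Set (Fin d → ℝ)), IsCompact Ω →
      ∀ μ : Measure Ω, IsProbabilityMeasure μ → ∀ F : Set C(Ω, ℂ), ∀ p : ℝ, 1 ≤ p → p ≤ 2 →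
        ∀ n : ℕ, recovE μ p F ⌈(4 : ℝ) * n⌉₊ ≤ ENNReal.ofReal 3 * kolmWidthInfE F n := by
    intro d Ω hΩ μ hμ F p hp1 hp2 n
    have : CompactSpace Ω := isCompact_iff_compactSpace.1 hΩ
    have hceil : ⌈(4 : ℝ) * n⌉₊ = 4 * n := by
      rw [← Nat.cast_ofNat, ← Nat.cast_mul, Nat.ceil_natCast]
    rw [hceil, ENNReal.ofReal_ofNat]
    exact recovE_le_three_mul_kolmWidthInfE μ F hp1 hp2 n
  exact ⟨4, 3, by norm_num, by norm_num,
    fun d Ω hΩ μ hμ F _ n => key d Ω hΩ μ hμ F 2 one_le_two le_rfl n,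
    fun d Ω hΩ μ hμ F _ p hp1 hp2 n => key d Ω hΩ μ hμ F p hp1 hp2 n⟩

end
end

section
/- Let X_N be an N-dimensional subspace of C(Ω), 1 ≤ p < ∞, ξ = {ξ^1,…,ξ^m} ⊂ Ω, and let w = (w_1,…,w_m) be a positive weight. Assume (A1) there is a constant C_1 > 0 such that C_1‖u‖_p ≤ ‖S(u,ξ)‖_{p,w} for all u ∈ X_N, and (A2) there is a constant C_2 > 0 such that Σ_{ν=1}^m w_ν ≤ C_2. Then for every f ∈ C(Ω), ‖f − ℓpw(ξ)(f)‖_p ≤ (2 C_1^{-1} C_2^{1/p} + 1) · d(f, X_N)_∞. -/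
open MeasureTheory ENNReal

noncomputable section

/-- The weighted discrete norm `‖S(f,ξ)‖_{p,w} = (∑_ν w_ν |f(ξ^ν)|^p)^{1/p}`. -/
def wNormE {α : Type*} {m : ℕ} (p : ℝ) (w : Fin m → ℝ) (ξ : Fin m → α) (f : α → ℂ) : ℝ≥0∞ :=
  (∑ ν, ENNReal.ofReal (w ν) * (‖f (ξ ν)‖₊ : ℝ≥0∞) ^ p) ^ (1 / p)

/-- The best approximation `d(f, X)_∞ = inf_{u ∈ X} ‖f - u‖_∞` of `f` by elements of `X`
in the uniform norm. -/
def distInfE {α : Type*} [TopologicalSpace α] (f : C(α, ℂ)) (X : Submodule ℂ C(α, ℂ)) : ℝ≥0∞ :=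
  ⨅ u : X, supNormE (fun x => f x - (u : C(α, ℂ)) x)

theorem lpNormE_add_le {α : Type*} [MeasurableSpace α] (μ : Measure α) {p : ℝ} (hp : 1 ≤ p)
    {f g : α → ℂ} (hf : Measurable f) (hg : Measurable g) :
    lpNormE μ p (fun x => f x + g x) ≤ lpNormE μ p f + lpNormE μ p g := by
  have hp0 : 0 ≤ p := by linarith
  refine le_trans ?_ (ENNReal.lintegral_Lp_add_le (μ := μ) (p := p)
    (f := fun x => (‖f x‖₊ : ℝ≥0∞)) (g := fun x => (‖g x‖₊ : ℝ≥0∞))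
    (by fun_prop) (by fun_prop) hp)
  unfold lpNormE
  gcongr with x
  simp only [Pi.add_apply]
  exact_mod_cast nnnorm_add_le (f x) (g x)

theorem lpNormE_le_supNormE {α : Type*} [MeasurableSpace α] (μ : Measure α)
    [IsProbabilityMeasure μ] {p : ℝ} (hp : 0 < p) (f : α → ℂ) :
    lpNormE μ p f ≤ supNormE f := by
  unfold lpNormE
  rw [one_div, ENNReal.rpow_inv_le_iff hp]
  calc ∫⁻ x, (‖f x‖₊ : ℝ≥0∞) ^ p ∂μ ≤ ∫⁻ _, supNormE f ^ p ∂μ := by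
        gcongr with x
        exact le_iSup (fun x => (‖f x‖₊ : ℝ≥0∞)) x
    _ = supNormE f ^ p := by simp

theorem wNormE_add_le {α : Type*} {m : ℕ} {p : ℝ} (hp : 1 ≤ p) (w : Fin m → ℝ)
    (ξ : Fin m → α) (f g : α → ℂ) :
    wNormE p w ξ (fun x => f x + g x) ≤ wNormE p w ξ f + wNormE p w ξ g := by
  have hp0 : 0 < p := by linarith
  have key (a b : ℝ≥0∞) : a * b ^ p = (a ^ (1 / p) * b) ^ p := by
    rw [ENNReal.mul_rpow_of_nonneg _ _ hp0.le, ← ENNReal.rpow_mul, one_div_mul_cancel hp0.ne',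
      ENNReal.rpow_one]
  unfold wNormE
  simp only [key]
  refine le_trans ?_ (ENNReal.Lp_add_le Finset.univ _ _ hp)
  gcongr with ν
  rw [← mul_add]
  gcongr
  exact_mod_cast nnnorm_add_le (f (ξ ν)) (g (ξ ν))

theorem wNormE_neg {α : Type*} {m : ℕ} (p : ℝ) (w : Fin m → ℝ) (ξ : Fin m → α) (f : α → ℂ) :
    wNormE p w ξ (fun x => -f x) = wNormE p w ξ f := by
  simp [wNormE]

theorem wNormE_le_mul_supNormE {α : Type*} {m : ℕ} {p : ℝ} (hp : 0 < p) {w : Fin m → ℝ}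
    (hw : ∀ ν, 0 ≤ w ν) {C : ℝ} (hC : ∑ ν, w ν ≤ C) (ξ : Fin m → α) (f : α → ℂ) :
    wNormE p w ξ f ≤ ENNReal.ofReal (C ^ (1 / p)) * supNormE f := by
  have hC0 : 0 ≤ C := (Finset.sum_nonneg fun ν _ => hw ν).trans hC
  have hp' : 0 ≤ 1 / p := by positivity
  calc wNormE p w ξ f
      ≤ (∑ ν, ENNReal.ofReal (w ν) * supNormE f ^ p) ^ (1 / p) := by
        unfold wNormE
        gcongr with ν
        exact le_iSup (fun x => (‖f x‖₊ : ℝ≥0∞)) (ξ ν)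
    _ ≤ (ENNReal.ofReal C * supNormE f ^ p) ^ (1 / p) := by
        rw [← Finset.sum_mul, ← ENNReal.ofReal_sum_of_nonneg fun ν _ => hw ν]
        gcongr
    _ = ENNReal.ofReal (C ^ (1 / p)) * supNormE f := by
        rw [ENNReal.mul_rpow_of_nonneg _ _ hp', ENNReal.ofReal_rpow_of_nonneg hC0 hp',
          ← ENNReal.rpow_mul, mul_one_div_cancel hp.ne', ENNReal.rpow_one]

/-- **Theorem 2.1 (conditional theorem).** Let `X_N` be an `N`-dimensional subspace of `C(Ω)`,
`1 ≤ p < ∞`, `ξ = {ξ^1,…,ξ^m} ⊆ Ω` and `w` a positive weight. Under the discretization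
assumption (A1): `C₁ ‖u‖_p ≤ ‖S(u,ξ)‖_{p,w}` for all `u ∈ X_N`, and the weight assumption
(A2): `∑_ν w_ν ≤ C₂`, for every `f ∈ C(Ω)` the weighted least squares recovery
`ℓpw(ξ)(f) = argmin_{u ∈ X_N} ‖S(f-u,ξ)‖_{p,w}` (formalized as: any `g ∈ X_N` minimizing
`‖S(f-·,ξ)‖_{p,w}`) satisfies `‖f - ℓpw(ξ)(f)‖_p ≤ (2 C₁⁻¹ C₂^{1/p} + 1) d(f, X_N)_∞`. -/
theorem weighted_least_squares_error_bound
    {d : ℕ} (Ω : Set (Fin d → ℝ)) (hΩ : IsCompact Ω)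
    (μ : Measure Ω) [IsProbabilityMeasure μ]
    (N : ℕ) (X : Submodule ℂ C(Ω, ℂ)) (hXdim : Module.finrank ℂ X = N)
    (p : ℝ) (hp : 1 ≤ p)
    (m : ℕ) (ξ : Fin m → Ω) (w : Fin m → ℝ) (hw : ∀ ν, 0 < w ν)
    (C₁ : ℝ) (hC₁ : 0 < C₁)
    (hA1 : ∀ u ∈ X, ENNReal.ofReal C₁ * lpNormE μ p (fun x => u x) ≤
      wNormE p w ξ (fun x => u x))
    (C₂ : ℝ) (hC₂ : 0 < C₂) (hA2 : ∑ ν, w ν ≤ C₂)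
    (f : C(Ω, ℂ)) (g : C(Ω, ℂ)) (hg : g ∈ X)
    (hmin : ∀ u ∈ X, wNormE p w ξ (fun x => f x - g x) ≤ wNormE p w ξ (fun x => f x - u x)) :
    lpNormE μ p (fun x => f x - g x) ≤
      ENNReal.ofReal (2 * C₁⁻¹ * C₂ ^ (1 / p) + 1) * distInfE f X := by
  have hp0 : 0 < p := by linarith
  set K := 2 * C₁⁻¹ * C₂ ^ (1 / p) + 1 with hK
  have hKpos : 0 < K := by positivity
  rw [distInfE, ENNReal.mul_iInf_of_ne (by simpa using hKpos) ENNReal.ofReal_ne_top]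
  refine le_iInf fun ⟨u, hu⟩ => ?_
  set D := supNormE (fun x => f x - u x)
  set E := ENNReal.ofReal (C₂ ^ (1 / p)) with hE
  have hfu : wNormE p w ξ (fun x => f x - u x) ≤ E * D :=
    wNormE_le_mul_supNormE hp0 (fun ν => (hw ν).le) hA2 ξ _
  have hug : wNormE p w ξ (fun x => (u - g) x) ≤ 2 * (E * D) := by
    calc wNormE p w ξ (fun x => (u - g) x)
        = wNormE p w ξ (fun x => -(f x - u x) + (f x - g x)) := by
          congr 1; ext x; simp
      _ ≤ wNormE p w ξ (fun x => -(f x - u x)) + wNormE p w ξ (fun x => f x - g x) :=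
          wNormE_add_le hp w ξ _ _
      _ ≤ E * D + E * D := by
          rw [wNormE_neg p w ξ (fun x => f x - u x)]
          exact add_le_add hfu ((hmin u hu).trans hfu)
      _ = 2 * (E * D) := (two_mul _).symm
  have hlp : lpNormE μ p (fun x => (u - g) x) ≤ ENNReal.ofReal C₁⁻¹ * (2 * (E * D)) := by
    rw [ENNReal.ofReal_inv_of_pos hC₁, mul_comm, ← div_eq_mul_inv,
      ENNReal.le_div_iff_mul_le (by simp [hC₁]) (by simp), mul_comm]
    exact (hA1 _ (X.sub_mem hu hg)).trans hug
  calc lpNormE μ p (fun x => f x - g x)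
      = lpNormE μ p (fun x => (u - g) x + (f x - u x)) := by
        congr 1; ext x; simp
    _ ≤ lpNormE μ p (fun x => (u - g) x) + lpNormE μ p (fun x => f x - u x) :=
        lpNormE_add_le μ hp (u - g).continuous.measurable (f - u).continuous.measurable
    _ ≤ ENNReal.ofReal C₁⁻¹ * (2 * (E * D)) + D :=
        add_le_add hlp (lpNormE_le_supNormE μ hp0 _)
    _ = ENNReal.ofReal K * D := by
        rw [hK, ENNReal.ofReal_add (by positivity) zero_le_one,
          ENNReal.ofReal_mul (by positivity), ENNReal.ofReal_mul zero_le_two, ← hE,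
          ENNReal.ofReal_ofNat, ENNReal.ofReal_one]
        ring

end
end

section
/- There are three positive absolute constants C_1, C_2, C_3 with the following property: for any d ∈ ℕ and any finite set Q ⊂ ℤ^d there exists a set of m ≤ C_1 |Q| points ξ^1,…,ξ^m ∈ 𝕋^d such that for every trigonometric polynomial f ∈ T(Q), C_2 ‖f‖_2^2 ≤ (1/m) Σ_{j=1}^m |f(ξ^j)|^2 ≤ C_3 ‖f‖_2^2. -/
open MeasureTheory ENNReal Real

noncomputable section

instance : Fact (0 < 2 * Real.pi) := ⟨by positivity⟩

/-- The `d`-dimensional torus `𝕋^d`. -/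
abbrev Torus (d : ℕ) := Fin d → AddCircle (2 * Real.pi)

/-- The normalized Lebesgue measure `(2π)^{-d} dx` on `𝕋^d`. -/
def torusMeasure (d : ℕ) : Measure (Torus d) :=
  (ENNReal.ofReal ((2 * Real.pi) ^ d))⁻¹ • volume

/-- The trigonometric character `e^{i(k,x)}`, `k ∈ ℤ^d`, on `𝕋^d`. -/
def trigChar {d : ℕ} (k : Fin d → ℤ) : Torus d → ℂ :=
  fun x => ∏ j, fourier (k j) (x j)

/-- The space `T(Q)` of trigonometric polynomials with frequencies in `Q ⊆ ℤ^d`. -/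
def trigPoly {d : ℕ} (Q : Finset (Fin d → ℤ)) : Submodule ℂ (Torus d → ℂ) :=
  Submodule.span ℂ (trigChar '' (Q : Set (Fin d → ℤ)))

section MultiAffine

variable {κ : Type*} [DecidableEq κ] {R : Type*} [CommRing R]

/-- The backward difference of `f` in the direction of the `i`-th coordinate. For functions that
are affine in each coordinate this is the partial derivative. -/
def bdiff (f : (κ → R) → R) (i : κ) : (κ → R) → R :=
  fun y => f y - f (y - Pi.single i 1)

/-- Functions which are affine in each coordinate separately. -/
def MultiAffine (f : (κ → R) → R) : Prop :=
  ∀ y i s, f (y + Pi.single i s) = f y + s * bdiff f i y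

lemma bdiff_comm (f : (κ → R) → R) (i j : κ) : bdiff (bdiff f i) j = bdiff (bdiff f j) i := by
  funext y
  simp only [bdiff, sub_right_comm y (Pi.single j 1) (Pi.single i 1)]
  ring

lemma MultiAffine.bdiff {f : (κ → R) → R} (hf : MultiAffine f) (j : κ) :
    MultiAffine (bdiff f j) := by
  intro y i s
  have h := hf (y - Pi.single j 1) i s
  simp only [_root_.bdiff] at h ⊢
  rw [hf y, add_sub_right_comm y (Pi.single i s), h,
    sub_right_comm y (Pi.single j 1) (Pi.single i 1)]
  simp only [_root_.bdiff]
  ring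

lemma MultiAffine.bdiff_self {f : (κ → R) → R} (hf : MultiAffine f) (i : κ) (y : κ → R) :
    _root_.bdiff (_root_.bdiff f i) i y = 0 := by
  have h1 := hf y i (-2)
  have e : y + Pi.single i (-2 : R) = y - Pi.single i 1 - Pi.single i 1 := by
    rw [sub_sub, ← Pi.single_add, sub_eq_add_neg, ← Pi.single_neg]; norm_num
  rw [e] at h1
  simp only [_root_.bdiff] at h1 ⊢
  rw [h1]; ring

lemma MultiAffine.add_two {f : (κ → R) → R} (hf : MultiAffine f) (i j : κ) (y : κ → R)
    (s u : R) : f (y + Pi.single i s + Pi.single j u) =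
      f y + s * _root_.bdiff f i y + u * _root_.bdiff f j y +
        s * u * _root_.bdiff (_root_.bdiff f i) j y := by
  rw [hf _ j u, hf _ i s, hf.bdiff j _ i s, bdiff_comm f j i]
  ring

/-- The weighted average of two translates of `f` along coordinate directions. -/
def shiftAvg (a b : R) (i j : κ) (f : (κ → R) → R) : (κ → R) → R :=
  fun y => a * f (y - Pi.single i 1) + b * f (y - Pi.single j 1)

lemma shiftAvg_eq {a b : R} (hab : a + b = 1) (i j : κ) (f : (κ → R) → R) (y : κ → R) :
    shiftAvg a b i j f y = f y - a * bdiff f i y - b * bdiff f j y := by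
  simp only [shiftAvg, bdiff]
  linear_combination (f y) * hab

lemma bdiff_shiftAvg (a b : R) (i j k : κ) (f : (κ → R) → R) :
    bdiff (shiftAvg a b i j f) k = shiftAvg a b i j (bdiff f k) := by
  funext y
  simp only [bdiff, shiftAvg, sub_right_comm y (Pi.single k 1)]
  ring

lemma MultiAffine.shiftAvg {f : (κ → R) → R} (hf : MultiAffine f) (a b : R) (i j : κ) :
    MultiAffine (shiftAvg a b i j f) := by
  intro y k s
  rw [bdiff_shiftAvg]
  simp only [_root_.shiftAvg, add_sub_right_comm y (Pi.single k s)]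
  rw [hf, hf]
  ring

end MultiAffine

section Stable

variable {κ : Type*} [DecidableEq κ]

/-- Real multiaffine functions that extend to a complex multiaffine function without zeros in the
product of open upper half-planes. -/
def RealStable (f : (κ → ℝ) → ℝ) : Prop :=
  ∃ F : (κ → ℂ) → ℂ, MultiAffine F ∧ Continuous F ∧
    (∀ z : κ → ℂ, (∀ k, 0 < (z k).im) → F z ≠ 0) ∧ ∀ y : κ → ℝ, F (fun k => (y k : ℂ)) = f y

lemma ofReal_sub_single (y : κ → ℝ) (i : κ) :
    (fun k => (((y - Pi.single i 1 : κ → ℝ) k : ℝ) : ℂ)) =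
      (fun k => (y k : ℂ)) - Pi.single i 1 := by
  funext k
  by_cases h : k = i
  · subst h; simp
  · simp [h]

lemma bdiff_ofReal {F : (κ → ℂ) → ℂ} {f : (κ → ℝ) → ℝ}
    (h : ∀ y : κ → ℝ, F (fun k => (y k : ℂ)) = f y) (i : κ) (y : κ → ℝ) :
    bdiff F i (fun k => (y k : ℂ)) = bdiff f i y := by
  simp only [bdiff, Complex.ofReal_sub]
  rw [← h, ← h, ofReal_sub_single]

lemma RealStable.multiAffine {f : (κ → ℝ) → ℝ} (hf : RealStable f) : MultiAffine f := by
  obtain ⟨F, hF, -, -, h⟩ := hf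
  intro y i s
  have h1 := hF (fun k => (y k : ℂ)) i s
  rw [bdiff_ofReal h, h] at h1
  have e : (fun k => (y k : ℂ)) + Pi.single i (s : ℂ) =
      fun k => (((y + Pi.single i s : κ → ℝ) k : ℝ) : ℂ) := by
    funext k
    by_cases hk : k = i
    · subst hk; simp
    · simp [hk]
  rw [e, h] at h1
  exact_mod_cast h1

lemma im_logDeriv_neg {F : (κ → ℂ) → ℂ} (hF : MultiAffine F)
    (h0 : ∀ z : κ → ℂ, (∀ k, 0 < (z k).im) → F z ≠ 0) {z : κ → ℂ} (hz : ∀ k, 0 < (z k).im)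
    (i : κ) : bdiff F i z / F z = 0 ∨ (bdiff F i z / F z).im < 0 := by
  by_cases hr : bdiff F i z / F z = 0
  · exact Or.inl hr
  right
  by_contra! hcon
  set r := bdiff F i z / F z with hrdef
  have hFz := h0 z hz
  refine h0 (z + Pi.single i (-r⁻¹)) (fun k => ?_) ?_
  · by_cases hk : k = i
    · subst hk
      have : 0 ≤ (-r⁻¹).im := by
        rw [Complex.neg_im, Complex.inv_im, neg_div, neg_neg]
        exact div_nonneg hcon (Complex.normSq_nonneg _)
      simp only [Pi.add_apply, Pi.single_eq_same, Complex.add_im]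
      have := hz k
      linarith
    · simpa [hk] using hz k
  · have hb : bdiff F i z = r * F z := by rw [hrdef]; field_simp
    rw [hF, hb]
    field_simp
    ring

lemma RealStable.shiftAvg {f : (κ → ℝ) → ℝ} (hf : RealStable f) {a b : ℝ} (ha : 0 ≤ a)
    (hb : 0 ≤ b) (hab : a + b = 1) (i j : κ) : RealStable (shiftAvg a b i j f) := by
  obtain ⟨F, hF, hc, h0, h⟩ := hf
  refine ⟨_root_.shiftAvg (a : ℂ) b i j F, hF.shiftAvg _ _ _ _, ?_, fun z hz => ?_, fun y => ?_⟩
  · unfold _root_.shiftAvg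
    fun_prop
  · have hab' : (a : ℂ) + b = 1 := by exact_mod_cast hab
    rw [shiftAvg_eq hab']
    have hFz := h0 z hz
    have key : ∀ (c : ℝ), 0 ≤ c → ∀ k, (c : ℂ) * (bdiff F k z / F z) = 0 ∨
        ((c : ℂ) * (bdiff F k z / F z)).im < 0 := by
      intro c hc k
      rcases im_logDeriv_neg hF h0 hz k with h1 | h1
      · left; rw [h1, mul_zero]
      · rcases hc.eq_or_lt with rfl | hc
        · left; simp
        · right; rw [Complex.im_ofReal_mul]; exact mul_neg_of_pos_of_neg hc h1
    intro hcon
    have h2 : (a : ℂ) * (bdiff F i z / F z) + b * (bdiff F j z / F z) = 1 := by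
      field_simp
      linear_combination -hcon
    have h3 := congrArg Complex.im h2
    rw [Complex.add_im, Complex.one_im] at h3
    rcases key a ha i with h4 | h4 <;> rcases key b hb j with h5 | h5
    · rw [h4, h5] at h2; simp at h2
    · rw [h4, Complex.zero_im] at h3; linarith
    · rw [h5, Complex.zero_im] at h3; linarith
    · linarith
  · simp only [_root_.shiftAvg]
    rw [← ofReal_sub_single, ← ofReal_sub_single, h, h]
    push_cast
    rfl

/-- The Rayleigh inequality for real stable multiaffine functions. -/
lemma RealStable.rayleigh {f : (κ → ℝ) → ℝ} (hf : RealStable f) {i j : κ} (hij : i ≠ j)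
    (y : κ → ℝ) : f y * bdiff (bdiff f i) j y ≤ bdiff f i y * bdiff f j y := by
  obtain ⟨F, hF, hc, h0, h⟩ := hf
  by_contra! hcon
  set a := f y
  set b := bdiff f i y with hb
  set c := bdiff f j y with hcdef
  set d := bdiff (bdiff f i) j y with hd
  let p : ℝ → κ → ℂ := fun η k => (y k : ℂ) + η * Complex.I
  have hp : Continuous p := by fun_prop
  have hp0 : p 0 = fun k => (y k : ℂ) := by funext k; simp [p]
  have cb : ∀ k, Continuous (bdiff F k) := fun k => by unfold bdiff; fun_prop
  have cbb : Continuous (bdiff (bdiff F i) j) := by unfold bdiff; fun_prop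
  let den : ℝ → ℂ := fun η => bdiff F j (p η) + Complex.I * bdiff (bdiff F i) j (p η)
  let num : ℝ → ℂ := fun η => F (p η) + Complex.I * bdiff F i (p η)
  have cden : Continuous den := by
    have := cb j
    fun_prop
  have cnum : Continuous num := by
    have := cb i
    fun_prop
  have den0 : den 0 = c + Complex.I * d := by
    simp only [den, hp0, bdiff_ofReal h, bdiff_ofReal (bdiff_ofReal h i)]; rfl
  have num0 : num 0 = a + Complex.I * b := by
    simp only [num, hp0, bdiff_ofReal h, h]; rfl
  have hcd : 0 < c ^ 2 + d ^ 2 := by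
    by_contra! h1
    have hc0 : c = 0 := by nlinarith [sq_nonneg c, sq_nonneg d]
    have hd0 : d = 0 := by nlinarith [sq_nonneg c, sq_nonneg d]
    rw [hc0, hd0] at hcon
    simp at hcon
  have nd : Complex.normSq (den 0) = c ^ 2 + d ^ 2 := by
    rw [den0, Complex.normSq_apply]; simp; ring
  have hden0 : den 0 ≠ 0 := by
    intro h1; rw [h1] at nd; simp at nd; linarith
  have him : 0 < (-(num 0 / den 0)).im := by
    rw [Complex.neg_im, Complex.div_im, nd, num0, den0]
    simp only [Complex.add_im, Complex.ofReal_im, Complex.mul_im, Complex.I_re, Complex.I_im,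
      Complex.ofReal_re, Complex.add_re, Complex.mul_re]
    rw [← sub_div, ← neg_div]
    apply div_pos _ hcd
    linarith
  have ct : ContinuousAt (fun η => (-(num η / den η)).im) 0 :=
    Complex.continuous_im.continuousAt.comp
      ((cnum.continuousAt.div cden.continuousAt hden0).neg)
  have ev : ∀ᶠ η in nhdsWithin (0 : ℝ) (Set.Ioi 0),
      0 < η ∧ den η ≠ 0 ∧ 0 < (-(num η / den η)).im := by
    refine (eventually_mem_nhdsWithin).and ?_
    exact nhdsWithin_le_nhds ((cden.continuousAt.eventually_ne hden0).and
      (ct.eventually_const_lt him))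
  obtain ⟨η, hη, hdη, hu⟩ := ev.exists
  refine h0 (p η + Pi.single i Complex.I + Pi.single j (-(num η / den η))) (fun k => ?_) ?_
  · have hpk : (p η k).im = η := by simp [p]
    by_cases hki : k = i
    · subst hki
      simp [hij, hpk]; linarith
    · by_cases hkj : k = j
      · subst hkj
        simp only [Pi.add_apply, Pi.single_eq_same, Complex.add_im, hpk, Pi.single_eq_of_ne hki,
          Complex.zero_im]
        linarith
      · simp [hki, hkj, hpk, hη]
  · rw [hF.add_two]
    have : num η / den η * den η = num η := by field_simp
    simp only [num, den] at this ⊢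
    linear_combination -this

end Stable

section Barrier

lemma quadratic_barrier_aux {g0 g1 g2 W0 W1 W2 δ : ℝ}
    (hg : ∀ s, -δ ≤ s → 0 < g0 + g1 * s + g2 * s ^ 2) (hg0 : 0 < g0) (hW0 : W0 ≤ 0)
    (hg2 : 0 ≤ g2) (hg1 : 0 ≤ g1 - δ * g2) (pl : g0 * W2 - g1 * W1 + g2 * W0 = 0) (disc : W1 ^ 2 ≤ W0 * W2) :
    0 ≤ W1 * g0 - W0 * (g1 - δ * g2) := by
  rcases le_or_gt 0 W1 with h | h
  · nlinarith [mul_nonneg h hg0.le, mul_nonneg (neg_nonneg.2 hW0) hg1]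
  · have hW0' : W0 < 0 := by
      rcases hW0.lt_or_eq with h' | h'
      · exact h'
      · rw [h'] at disc; nlinarith [sq_nonneg W1, mul_pos_of_neg_of_neg h h]
    -- `r` is a point between the roots of the reversed quadratic
    set r := W1 / W0 with hr
    have hrpos : 0 < r := div_pos_of_neg_of_neg h hW0'
    have hW1r : W1 = r * W0 := (div_mul_cancel₀ W1 hW0'.ne).symm
    have h2 : r ^ 2 * W0 ≥ W2 := by
      rw [hW1r] at disc
      have : W0 * (W2 - r ^ 2 * W0) ≥ 0 := by nlinarith
      by_contra! hcon
      nlinarith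
    have h3 : g0 * r ^ 2 - g1 * r + g2 ≤ 0 := by
      have : W0 * (g0 * r ^ 2 - g1 * r + g2) ≥ 0 := by
        rw [hW1r] at pl
        nlinarith
      by_contra! hcon
      nlinarith
    have h4 : δ * r < 1 := by
      by_contra! hcon
      have h5 := hg (-r⁻¹) (by
        have : r⁻¹ ≤ δ := by rw [inv_le_iff_one_le_mul₀ hrpos]; linarith
        linarith)
      have h6 : (g0 + g1 * -r⁻¹ + g2 * (-r⁻¹) ^ 2) * r ^ 2 = g0 * r ^ 2 - g1 * r + g2 := by
        field_simp
        ring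
      have := mul_pos h5 (pow_pos hrpos 2)
      linarith
    have h5 : g0 * r ≤ g1 - δ * g2 := by
      have : r * (g0 * r - g1 + δ * g2) ≤ 0 := by
        nlinarith [mul_nonneg hg2 (by linarith : 0 ≤ 1 - δ * r)]
      by_contra! hcon
      nlinarith
    rw [hW1r]
    nlinarith

/-- Convexity and monotonicity of the logarithmic derivative of a pencil of interlacing quadratics,
in the form needed for the barrier argument. -/
lemma quadratic_barrier {g0 g1 g2 h0 h1 h2 δ φ : ℝ} (hδ : 0 < δ)
    (hg : ∀ s, -δ ≤ s → 0 < g0 + g1 * s + g2 * s ^ 2)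
    (hW : ∀ s, (g0 * h1 - h0 * g1) + 2 * (g0 * h2 - h0 * g2) * s
      + (g1 * h2 - h1 * g2) * s ^ 2 ≤ 0)
    (hh : h0 - δ * h1 + δ ^ 2 * h2 ≤ φ * (g0 - δ * g1 + δ ^ 2 * g2))
    (hg2 : 0 ≤ g2) (hg1' : 0 ≤ g1 - 2 * δ * g2) (hgδ : g1 * δ ≤ (2 * δ - 1) * g0) (hpos : 0 < g0 - g1 / 2) :
    h0 - h1 / 2 ≤ φ * (g0 - g1 / 2) := by
  have hg0 : 0 < g0 := by simpa using hg 0 (by linarith)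
  have hgm : 0 < g0 - δ * g1 + δ ^ 2 * g2 := by
    have := hg (-δ) le_rfl
    nlinarith
  set W0 := g0 * h1 - h0 * g1 with hW0d
  set W1 := g0 * h2 - h0 * g2 with hW1d
  set W2 := g1 * h2 - h1 * g2 with hW2d
  have hW0 : W0 ≤ 0 := by simpa using hW 0
  have pl : g0 * W2 - g1 * W1 + g2 * W0 = 0 := by rw [hW0d, hW1d, hW2d]; ring
  have disc : W1 ^ 2 ≤ W0 * W2 := by
    have := discrim_le_zero_of_nonpos (a := W2) (b := 2 * W1) (c := W0)
      (fun s => by have := hW s; nlinarith)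
    unfold discrim at this
    nlinarith
  have hg1 : 0 ≤ g1 - δ * g2 := by nlinarith [mul_nonneg hδ.le hg2]
  have hK := quadratic_barrier_aux hg hg0 hW0 hg2 hg1 pl disc
  have e1 : (h0 - δ * h1 + δ ^ 2 * h2) * g0 - h0 * (g0 - δ * g1 + δ ^ 2 * g2) =
      -δ * W0 + δ ^ 2 * W1 := by rw [hW0d, hW1d]; ring
  have e2 : (h0 - h1 / 2) * g0 = h0 * (g0 - g1 / 2) - W0 / 2 := by rw [hW0d]; ring
  set gm := g0 - δ * g1 + δ ^ 2 * g2 with hgmd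
  set hm := h0 - δ * h1 + δ ^ 2 * h2 with hhmd
  have key1 : (-δ * W0 + δ ^ 2 * W1) * g0 ≥ -δ * W0 * gm := by
    have : (-δ * W0 + δ ^ 2 * W1) * g0 - (-δ * W0 * gm) =
      δ ^ 2 * (W1 * g0 - W0 * (g1 - δ * g2)) := by rw [hgmd]; ring
    nlinarith [mul_nonneg (sq_nonneg δ) hK]
  have key2 : 0 ≤ g0 ^ 2 * (hm * (g0 - g1 / 2) - (h0 - h1 / 2) * gm) := by
    have e3 : g0 ^ 2 * (hm * (g0 - g1 / 2) - (h0 - h1 / 2) * gm) =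
        (g0 - g1 / 2) * ((-δ * W0 + δ ^ 2 * W1) * g0) + W0 / 2 * g0 * gm := by
      rw [← e1]
      linear_combination (-g0 * gm) * e2
    rw [e3]
    have h7 : 0 ≤ gm * (-W0) * ((2 * δ - 1) * g0 - g1 * δ) :=
      mul_nonneg (mul_nonneg hgm.le (by linarith)) (by linarith)
    have h8 := mul_le_mul_of_nonneg_left key1 hpos.le
    linarith
  have key3 : 0 ≤ hm * (g0 - g1 / 2) - (h0 - h1 / 2) * gm :=
    nonneg_of_mul_nonneg_right key2 (by positivity)
  have key4 := mul_le_mul_of_nonneg_right hh hpos.le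
  refine le_of_mul_le_mul_right ?_ hgm
  nlinarith

variable {κ : Type*} [DecidableEq κ]

lemma le_add_single {x y : κ → ℝ} (hxy : x ≤ y) (k : κ) {s : ℝ} (hs : 0 ≤ s) :
    x ≤ y + Pi.single k s :=
  hxy.trans (le_add_of_nonneg_right (Pi.single_nonneg.2 hs))

lemma nonneg_of_forall_add_mul_nonneg {a b : ℝ} (h : ∀ s, 0 ≤ s → 0 ≤ a + s * b) : 0 ≤ b := by
  by_contra! hb
  have := h ((|a| + 1) / (-b)) (div_nonneg (by positivity) (by linarith))
  have e : (|a| + 1) / (-b) * b = -(|a| + 1) := by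
    rw [div_mul_eq_mul_div, div_eq_iff (by linarith)]
    ring
  rw [e] at this
  linarith [le_abs_self a]

lemma MultiAffine.bdiff_nonneg {f : (κ → ℝ) → ℝ} (hf : MultiAffine f) {x : κ → ℝ}
    (h : ∀ y, x ≤ y → 0 ≤ f y) (k : κ) : ∀ y, x ≤ y → 0 ≤ _root_.bdiff f k y := by
  intro y hy
  refine nonneg_of_forall_add_mul_nonneg (a := f y) fun s hs => ?_
  rw [← hf]
  exact h _ (le_add_single hy k hs)

lemma bdiff_shiftAvg_le {f : (κ → ℝ) → ℝ} (hf : RealStable f) {p q : κ}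
    {x : κ → ℝ} {φ δ : ℝ} (hδ : 0 < δ) (hφ : 2 * φ * δ ≤ 2 * δ - 1)
    (hpos : ∀ y, x ≤ y → 0 < f y) (hp : ∀ y, x ≤ y → bdiff f p y ≤ φ * f y)
    (hq : ∀ y, x ≤ y → bdiff f q y ≤ φ * f y) {y : κ → ℝ}
    (hy : x + Pi.single p δ + Pi.single q δ ≤ y) :
    0 < shiftAvg (1 / 2) (1 / 2) p q f y ∧
      ∀ j, j ≠ p → j ≠ q → (∀ y, x ≤ y → bdiff f j y ≤ φ * f y) →
        bdiff (shiftAvg (1 / 2) (1 / 2) p q f) j y ≤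
          φ * shiftAvg (1 / 2) (1 / 2) p q f y := by
  have hφ1 : φ < 1 := by
    by_contra! h
    nlinarith
  have hmem : ∀ s, -δ ≤ s → x ≤ y + Pi.single p s + Pi.single q s := by
    intro s hs k
    have := hy k
    simp only [Pi.add_apply, Pi.single_apply] at this ⊢
    split_ifs at this ⊢ <;> linarith
  have hxy : x ≤ y := by simpa using hmem 0 (by linarith)
  have hfy := hpos y hxy
  have hA := hf.multiAffine
  have hsum : (1 / 2 : ℝ) + 1 / 2 = 1 := by norm_num
  have hTpos : 0 < f y - (bdiff f p y + bdiff f q y) / 2 := by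
    have h1 := hp y hxy
    have h2 := hq y hxy
    nlinarith
  have hfp := hA.bdiff_nonneg (fun y hy => (hpos y hy).le) p
  have hfq := hA.bdiff_nonneg (fun y hy => (hpos y hy).le) q
  have hfpq := (hA.bdiff p).bdiff_nonneg hfp q
  refine ⟨?_, fun j hjp hjq hj => ?_⟩
  · rw [shiftAvg_eq hsum]
    linarith
  rw [bdiff_shiftAvg, shiftAvg_eq hsum, shiftAvg_eq hsum]
  have := quadratic_barrier (g0 := f y) (g1 := bdiff f p y + bdiff f q y)
    (g2 := bdiff (bdiff f p) q y) (h0 := bdiff f j y)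
    (h1 := bdiff (bdiff f j) p y + bdiff (bdiff f j) q y)
    (h2 := bdiff (bdiff (bdiff f j) p) q y) (δ := δ) (φ := φ) hδ ?_ ?_ ?_
    (hfpq y hxy) ?_ ?_ hTpos
  · linarith
  · intro s hs
    have := hpos _ (hmem s hs)
    rw [hA.add_two] at this
    linarith
  · intro s
    have r1 := hf.rayleigh hjp (y + Pi.single p s + Pi.single q s)
    have r2 := hf.rayleigh hjq (y + Pi.single p s + Pi.single q s)
    have z1 := hA.bdiff_self p y
    have z2 := (hA.bdiff p).bdiff_self q y
    have z3 := (hA.bdiff j).bdiff_self p y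
    have z4 := ((hA.bdiff j).bdiff p).bdiff_self q y
    have z5 : bdiff (bdiff (bdiff f p) p) q y = 0 := by
      have : bdiff (bdiff f p) p = 0 := funext fun y => hA.bdiff_self p y
      rw [this]; simp [bdiff]
    have z6 : bdiff (bdiff (bdiff (bdiff f j) p) p) q y = 0 := by
      have : bdiff (bdiff (bdiff f j) p) p = 0 := funext fun y => (hA.bdiff j).bdiff_self p y
      rw [this]; simp [bdiff]
    have z7 := hA.bdiff_self q y
    have z8 : bdiff (bdiff (bdiff f q) p) q y = 0 := by rw [bdiff_comm f q p]; exact z2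
    have z9 := (hA.bdiff j).bdiff_self q y
    have z10 : bdiff (bdiff (bdiff (bdiff f j) q) p) q y = 0 := by
      rw [bdiff_comm (bdiff f j) q p]; exact z4
    rw [hA.add_two, (hA.bdiff j).add_two, ((hA.bdiff j).bdiff p).add_two, (hA.bdiff p).add_two]
      at r1
    rw [hA.add_two, (hA.bdiff j).add_two, ((hA.bdiff j).bdiff q).add_two, (hA.bdiff q).add_two]
      at r2
    rw [z1, z3, z5, z6] at r1
    rw [z7, z8, z9, z10, bdiff_comm f q p, bdiff_comm (bdiff f j) q p] at r2
    nlinarith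
  · have := hj _ (hmem (-δ) le_rfl)
    rw [hA.add_two, (hA.bdiff j).add_two] at this
    linarith
  · have h1 := hfp _ (hmem (-δ) le_rfl)
    have h2 := hfq _ (hmem (-δ) le_rfl)
    have z1 := hA.bdiff_self p y
    have z2 := (hA.bdiff p).bdiff_self q y
    have z5 : bdiff (bdiff (bdiff f p) p) q y = 0 := by
      have : bdiff (bdiff f p) p = 0 := funext fun y => hA.bdiff_self p y
      rw [this]; simp [bdiff]
    have z7 := hA.bdiff_self q y
    have z8 : bdiff (bdiff (bdiff f q) p) q y = 0 := by rw [bdiff_comm f q p]; exact z2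
    rw [(hA.bdiff p).add_two, z1, z5] at h1
    rw [(hA.bdiff q).add_two, z7, z8, bdiff_comm f q p] at h2
    linarith
  · have h1 := hp y hxy
    have h2 := hq y hxy
    nlinarith

end Barrier

section Selection

variable {κ : Type*} [DecidableEq κ]

lemma forall_of_forall_add_single [Finite κ] {x : κ → ℝ} {P : (κ → ℝ) → Prop} (hx : P x)
    (h : ∀ y, x ≤ y → P y → ∀ k s, 0 ≤ s → P (y + Pi.single k s)) : ∀ y, x ≤ y → P y := by
  intro y hy
  have := Fintype.ofFinite κ
  have key : ∀ S : Finset κ, P (x + ∑ k ∈ S, Pi.single k (y k - x k)) ∧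
      x ≤ x + ∑ k ∈ S, Pi.single k (y k - x k) := by
    intro S
    induction S using Finset.induction_on with
    | empty => simpa using hx
    | insert k S hk ih =>
      rw [Finset.sum_insert hk, add_comm (Pi.single k _), ← add_assoc]
      have hs : 0 ≤ y k - x k := sub_nonneg.2 (hy k)
      exact ⟨h _ ih.2 ih.1 k _ hs, le_add_single ih.2 k hs⟩
  have := (key Finset.univ).1
  have e : x + ∑ k, Pi.single k (y k - x k) = y := by
    funext k
    simp
  rwa [e] at this

lemma RealStable.translate {f : (κ → ℝ) → ℝ} (hf : RealStable f) (i : κ) :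
    RealStable fun y => f (y - Pi.single i 1) := by
  have := hf.shiftAvg zero_le_one le_rfl (add_zero 1) i i
  convert this using 2
  simp [_root_.shiftAvg]

lemma RealStable.translate_pos_of_bdiff_lt [Finite κ] {f : (κ → ℝ) → ℝ} (hf : RealStable f)
    {x : κ → ℝ} (hpos : ∀ y, x ≤ y → 0 < f y) {p : κ} (hp : bdiff f p x < f x) :
    ∀ y, x ≤ y → 0 < f (y - Pi.single p 1) := by
  have hA := hf.multiAffine
  have main : ∀ y, x ≤ y → bdiff f p y < f y := by
    refine forall_of_forall_add_single hp fun y hy h k s hs => ?_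
    have h1 := hpos y hy
    have h2 := hpos _ (le_add_single hy k hs)
    rw [hA.bdiff p]
    have h3 := hA.bdiff_nonneg (fun y hy => (hpos y hy).le) p y hy
    by_cases hk : k = p
    · subst hk
      rw [hA.bdiff_self, hA]
      nlinarith
    · have h4 := hf.rayleigh (Ne.symm hk) y
      rw [hA] at h2 ⊢
      by_contra! hcon
      nlinarith [mul_le_mul_of_nonneg_left h4 hs, mul_le_mul_of_nonneg_right hcon h1.le,
        mul_lt_mul_of_pos_right h h2]
  intro y hy
  have := main y hy
  simp only [bdiff] at this
  linarith

lemma RealStable.translate_pos_or [Finite κ] {f : (κ → ℝ) → ℝ} (hf : RealStable f)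
    {x : κ → ℝ} {p q : κ} (hpos : ∀ y, x ≤ y → 0 < _root_.shiftAvg (1 / 2) (1 / 2) p q f y) :
    (∀ y, x ≤ y → 0 < f (y - Pi.single p 1)) ∨ (∀ y, x ≤ y → 0 < f (y - Pi.single q 1)) := by
  have hA := hf.multiAffine
  have hsum : (1 / 2 : ℝ) + 1 / 2 = 1 := by norm_num
  have hT := hA.shiftAvg (1 / 2) (1 / 2) p q
  have h1 := hT.bdiff_nonneg (fun y hy => (hpos y hy).le) p
  have h2 := hT.bdiff_nonneg (fun y hy => (hpos y hy).le) q
  have h12 := (hT.bdiff p).bdiff_nonneg h1 q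
  have hf0 : ∀ y, x ≤ y → 0 < f y := by
    intro y hy
    have a0 := hpos y hy
    have a1 := h1 y hy
    have a2 := h2 y hy
    have a3 := h12 y hy
    have z1 := hA.bdiff_self p y
    have z2 := hA.bdiff_self q y
    have z3 : bdiff (bdiff (bdiff f p) q) p y = 0 := by
      rw [bdiff_comm (bdiff f p) q p]
      have : bdiff (bdiff f p) p = 0 := funext fun y => hA.bdiff_self p y
      rw [this]; simp [bdiff]
    have z4 := (hA.bdiff p).bdiff_self q y
    rw [bdiff_shiftAvg, bdiff_shiftAvg, shiftAvg_eq hsum, z3, z4] at a3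
    rw [bdiff_shiftAvg, shiftAvg_eq hsum, z1] at a1
    rw [bdiff_shiftAvg, shiftAvg_eq hsum, z2, bdiff_comm f q p] at a2
    rw [shiftAvg_eq hsum] at a0
    linarith
  have hx := hpos x le_rfl
  rw [shiftAvg_eq hsum] at hx
  rcases lt_or_ge (bdiff f p x) (f x) with h | h
  · exact Or.inl (hf.translate_pos_of_bdiff_lt hf0 h)
  · exact Or.inr (hf.translate_pos_of_bdiff_lt hf0 (by linarith))

end Selection

section Average

variable {ι : Type*} [DecidableEq ι]

/-- The average of the translates of `f` by the vectors `∑ i ∈ l, e_i`, where each `e_i` is one of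
the two basis vectors belonging to `i`. -/
def pairAvg : List ι → ((ι ⊕ ι → ℝ) → ℝ) → (ι ⊕ ι → ℝ) → ℝ
  | [], f => f
  | i :: l, f => shiftAvg (1 / 2) (1 / 2) (Sum.inl i) (Sum.inr i) (pairAvg l f)

lemma RealStable.pairAvg {f : (ι ⊕ ι → ℝ) → ℝ} (hf : RealStable f) (l : List ι) :
    RealStable (pairAvg l f) := by
  induction l with
  | nil => exact hf
  | cons i l ih => exact ih.shiftAvg (by norm_num) (by norm_num) (by norm_num) _ _

lemma pairAvg_translate (l : List ι) (f : (ι ⊕ ι → ℝ) → ℝ) (k : ι ⊕ ι) :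
    pairAvg l (fun y => f (y - Pi.single k 1)) = fun y => pairAvg l f (y - Pi.single k 1) := by
  induction l with
  | nil => rfl
  | cons i l ih =>
    funext y
    simp only [pairAvg, shiftAvg, ih, sub_right_comm y (Pi.single k 1)]

lemma pairAvg_pos {f : (ι ⊕ ι → ℝ) → ℝ} (hf : RealStable f) {t φ δ : ℝ} (hδ : 0 < δ)
    (hφ : 2 * φ * δ ≤ 2 * δ - 1) (hpos : ∀ y, (fun _ => t) ≤ y → 0 < f y)
    (hb : ∀ y, (fun _ => t) ≤ y → ∀ k, bdiff f k y ≤ φ * f y) {l : List ι} (hl : l.Nodup) :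
    ∀ y, (fun k => if Sum.elim id id k ∈ l then t + δ else t) ≤ y →
      0 < pairAvg l f y ∧ ∀ k : ι ⊕ ι, Sum.elim id id k ∉ l →
        bdiff (pairAvg l f) k y ≤ φ * pairAvg l f y := by
  induction l with
  | nil =>
    intro y hy
    simp only [List.not_mem_nil, if_false] at hy
    exact ⟨hpos y hy, fun k _ => hb y hy k⟩
  | cons i l ih =>
    rw [List.nodup_cons] at hl
    intro y hy
    have IH := ih hl.2
    have hle : (fun k => if Sum.elim id id k ∈ l then t + δ else t) +
        Pi.single (Sum.inl i) δ + Pi.single (Sum.inr i) δ ≤ y := by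
      refine le_trans (fun k => ?_) hy
      rcases k with k | k <;> by_cases hk : k = i
      · subst hk; simp [hl.1]
      · simp only [Pi.add_apply, Sum.elim_inl, List.mem_cons, id, hk, false_or,
          Pi.single_apply, Sum.inl.injEq, reduceCtorEq, if_false, add_zero]
        exact le_rfl
      · subst hk; simp [hl.1]
      · simp only [Pi.add_apply, Sum.elim_inr, List.mem_cons, id, hk, false_or,
          Pi.single_apply, Sum.inr.injEq, reduceCtorEq, if_false, add_zero]
        exact le_rfl
    have := bdiff_shiftAvg_le (hf.pairAvg l) hδ hφ (fun y hy => (IH y hy).1)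
      (fun y hy => (IH y hy).2 (Sum.inl i) hl.1) (fun y hy => (IH y hy).2 (Sum.inr i) hl.1) hle
    refine ⟨this.1, fun k hk => ?_⟩
    rw [List.mem_cons, not_or] at hk
    refine this.2 k ?_ ?_ fun y hy => (IH y hy).2 k hk.2
    · rintro rfl; exact hk.1 rfl
    · rintro rfl; exact hk.1 rfl

lemma exists_translate_pos [Finite ι] {x : ι ⊕ ι → ℝ} {l : List ι} (hl : l.Nodup) :
    ∀ {f : (ι ⊕ ι → ℝ) → ℝ}, RealStable f → (∀ y, x ≤ y → 0 < pairAvg l f y) →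
    ∃ S : Finset ι, ∀ y, x ≤ y → 0 < f (y - Sum.elim (fun i => if i ∈ l ∧ i ∈ S then 1 else 0)
      (fun i => if i ∈ l ∧ i ∉ S then 1 else 0)) := by
  induction l with
  | nil =>
    intro f _ h
    refine ⟨∅, fun y hy => ?_⟩
    have := h y hy
    simp only [pairAvg] at this
    convert this using 2
    funext k
    rcases k with k | k <;> simp
  | cons i l ih =>
    intro f hf h
    rw [List.nodup_cons] at hl
    rcases (hf.pairAvg l).translate_pos_or h with h1 | h1
    · obtain ⟨S, hS⟩ := ih hl.2 (hf.translate _)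
        fun y hy => by rw [pairAvg_translate]; exact h1 y hy
      refine ⟨insert i S, fun y hy => ?_⟩
      convert hS y hy using 2
      rw [sub_sub]
      congr 1
      funext k
      rcases k with k | k <;> by_cases hk : k = i
      · subst hk; simp [hl.1]
      · simp [hk]
      · subst hk; simp [hl.1]
      · simp [hk]
    · obtain ⟨S, hS⟩ := ih hl.2 (hf.translate _)
        fun y hy => by rw [pairAvg_translate]; exact h1 y hy
      refine ⟨S.erase i, fun y hy => ?_⟩
      convert hS y hy using 2
      rw [sub_sub]
      congr 1
      funext k
      rcases k with k | k <;> by_cases hk : k = i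
      · subst hk; simp [hl.1]
      · simp [hk]
      · subst hk; simp [hl.1]
      · simp [hk]

lemma exists_partition_pos [Fintype ι] {f : (ι ⊕ ι → ℝ) → ℝ} (hf : RealStable f) {t φ δ : ℝ}
    (hδ : 0 < δ) (hφ : 2 * φ * δ ≤ 2 * δ - 1) (hpos : ∀ y, (fun _ => t) ≤ y → 0 < f y)
    (hb : ∀ y, (fun _ => t) ≤ y → ∀ k, bdiff f k y ≤ φ * f y) :
    ∃ S : Finset ι, ∀ s, t + δ ≤ s → 0 < f (Sum.elim (fun i => if i ∈ S then s - 1 else s)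
      (fun i => if i ∈ S then s else s - 1)) := by
  have h := pairAvg_pos hf hδ hφ hpos hb (Finset.univ : Finset ι).nodup_toList
  obtain ⟨S, hS⟩ := exists_translate_pos (Finset.univ : Finset ι).nodup_toList hf
    fun y hy => (h y hy).1
  refine ⟨S, fun s hs => ?_⟩
  convert hS (fun _ => s) (fun k => by simpa using hs) using 2
  funext k
  rcases k with k | k <;> by_cases hk : k ∈ S <;> simp [hk]

end Average

section Determinant

open Matrix ComplexOrder

variable {ι n : Type*} [Fintype ι] [DecidableEq ι] [Fintype n] [DecidableEq n]

lemma det_add_smul_vecMulVec {R : Type*} [CommRing R] (M : Matrix n n R) (u w : n → R) (s : R) :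
    (M + s • vecMulVec u w).det = M.det + s * (M.det - (M - vecMulVec u w).det) := by
  let B : Matrix (n ⊕ Unit) (n ⊕ Unit) R := fromBlocks M (replicateCol Unit u) 0 1
  let r0 : n ⊕ Unit → R := Sum.elim 0 1
  let r1 : n ⊕ Unit → R := Sum.elim (-w) 0
  have key : ∀ s : R, (M + s • vecMulVec u w).det =
      (B.updateRow (Sum.inr ()) r0).det + s * (B.updateRow (Sum.inr ()) r1).det := by
    intro s
    rw [← det_updateRow_smul, ← det_updateRow_add]
    have e : B.updateRow (Sum.inr ()) (r0 + s • r1) =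
        fromBlocks M (replicateCol Unit u) (replicateRow Unit (-(s • w))) 1 := by
      ext (i | i) (j | j) <;> simp [B, r0, r1, updateRow_apply]
    rw [e, det_fromBlocks_one₂₂]
    congr 1
    ext i j
    simp [vecMulVec_apply, mul_apply]
    ring
  have h0 := key 0
  have h1 := key (-1)
  rw [zero_smul, add_zero] at h0
  rw [neg_one_smul, ← sub_eq_add_neg] at h1
  rw [key, h1, h0]
  ring

/-- The matrix `∑ i, z i • v i (v i)ᴴ`. -/
def frameMatrix (v : ι → n → ℂ) (z : ι → ℂ) : Matrix n n ℂ :=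
  ∑ i, z i • vecMulVec (v i) (star (v i))

/-- The squared modulus of the inner product of `v` and `x`. -/
def sqInner (v x : n → ℂ) : ℝ := Complex.normSq (star v ⬝ᵥ x)

omit [DecidableEq n] in
lemma sqInner_nonneg (v x : n → ℂ) : 0 ≤ sqInner v x := Complex.normSq_nonneg _

omit [DecidableEq n] in
lemma sqInner_smul (v x : n → ℂ) (c : ℝ) : sqInner v ((c : ℂ) • x) = c ^ 2 * sqInner v x := by
  simp only [sqInner, dotProduct_smul, smul_eq_mul, Complex.normSq_mul, Complex.normSq_ofReal]
  ring

omit [DecidableEq n] in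
lemma star_dotProduct_vecMulVec (v x : n → ℂ) :
    star x ⬝ᵥ (vecMulVec v (star v) *ᵥ x) = sqInner v x := by
  rw [vecMulVec_mulVec, sqInner, Complex.normSq_eq_conj_mul_self]
  have : (starRingEnd ℂ) (star v ⬝ᵥ x) = star x ⬝ᵥ v := by
    rw [starRingEnd_apply, ← star_dotProduct_star, star_star]
  rw [this, dotProduct_comm]
  simp [dotProduct_comm, mul_comm]

omit [DecidableEq ι] [DecidableEq n] in
lemma star_dotProduct_frameMatrix (v : ι → n → ℂ) (z : ι → ℂ) (x : n → ℂ) :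
    star x ⬝ᵥ (frameMatrix v z *ᵥ x) = ∑ i, z i * sqInner (v i) x := by
  simp only [frameMatrix, sum_mulVec, dotProduct_sum, smul_mulVec, dotProduct_smul,
    star_dotProduct_vecMulVec, smul_eq_mul]

omit [DecidableEq ι] [Fintype n] [DecidableEq n] in
lemma frameMatrix_isHermitian (v : ι → n → ℂ) (y : ι → ℝ) :
    (frameMatrix v fun i => (y i : ℂ)).IsHermitian := by
  simp only [IsHermitian, frameMatrix, conjTranspose_sum, conjTranspose_smul,
    conjTranspose_vecMulVec, star_star]
  simp

omit [DecidableEq n] in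
lemma frameMatrix_add_single (v : ι → n → ℂ) (z : ι → ℂ) (i : ι) (s : ℂ) :
    frameMatrix v (z + Pi.single i s) = frameMatrix v z + s • vecMulVec (v i) (star (v i)) := by
  simp only [frameMatrix, Pi.add_apply, add_smul, Finset.sum_add_distrib]
  congr 1
  rw [Finset.sum_eq_single i] <;> simp +contextual

lemma multiAffine_det_frameMatrix (v : ι → n → ℂ) :
    MultiAffine fun z => (frameMatrix v z).det := by
  intro z i s
  have e : z - Pi.single i 1 = z + Pi.single i (-1) := by rw [sub_eq_add_neg, Pi.single_neg]
  simp only [bdiff]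
  rw [e, frameMatrix_add_single, frameMatrix_add_single, det_add_smul_vecMulVec, neg_one_smul,
    ← sub_eq_add_neg]

omit [DecidableEq ι] in
lemma continuous_det_frameMatrix (v : ι → n → ℂ) :
    Continuous fun z => (frameMatrix v z).det := by
  unfold frameMatrix
  fun_prop

omit [DecidableEq ι] in
lemma det_frameMatrix_ne_zero {v : ι → n → ℂ} (hv : ∀ x, x ≠ 0 → 0 < ∑ i, sqInner (v i) x)
    {z : ι → ℂ} (hz : ∀ i, 0 < (z i).im) : (frameMatrix v z).det ≠ 0 := by
  intro h
  obtain ⟨x, hx, hx0⟩ := exists_mulVec_eq_zero_iff.2 h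
  have h1 := star_dotProduct_frameMatrix v z x
  rw [hx0, dotProduct_zero] at h1
  have h2 := congrArg Complex.im h1
  simp only [Complex.zero_im, Complex.im_sum, Complex.im_mul_ofReal] at h2
  obtain ⟨i, -, hi⟩ := Finset.exists_ne_zero_of_sum_ne_zero (hv x hx).ne'
  have : 0 < ∑ i, (z i).im * sqInner (v i) x := by
    refine Finset.sum_pos' (fun i _ => mul_nonneg (hz i).le (sqInner_nonneg _ _)) ⟨i, by simp, ?_⟩
    exact mul_pos (hz i) (lt_of_le_of_ne (sqInner_nonneg _ _) hi.symm)
  linarith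

omit [DecidableEq ι] in
lemma det_frameMatrix_im (v : ι → n → ℂ) (y : ι → ℝ) :
    ((frameMatrix v fun i => (y i : ℂ)).det).im = 0 := by
  have h := (frameMatrix_isHermitian v y)
  have h1 := congrArg det h.eq
  rw [det_conjTranspose] at h1
  exact Complex.conj_eq_iff_im.1 h1

/-- The determinant of `∑ i, y i • v i (v i)ᴴ` for real `y`. -/
def frameDet (v : ι → n → ℂ) (y : ι → ℝ) : ℝ := ((frameMatrix v fun i => (y i : ℂ)).det).re

omit [DecidableEq ι] in
lemma ofReal_frameDet (v : ι → n → ℂ) (y : ι → ℝ) :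
    (frameDet v y : ℂ) = (frameMatrix v fun i => (y i : ℂ)).det :=
  Complex.ext rfl (det_frameMatrix_im v y).symm

omit [DecidableEq ι] in
lemma frameDet_pos {v : ι → n → ℂ} (hv : ∀ x, x ≠ 0 → 0 < ∑ i, sqInner (v i) x) {y : ι → ℝ}
    {t : ℝ} (ht : 0 < t) (hy : ∀ i, t ≤ y i) : 0 < frameDet v y := by
  have : (frameMatrix v fun i => (y i : ℂ)).PosDef := by
    refine PosDef.of_dotProduct_mulVec_pos (frameMatrix_isHermitian v y) fun x hx => ?_
    rw [star_dotProduct_frameMatrix]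
    have h1 : 0 < ∑ i, y i * sqInner (v i) x := by
      refine (mul_pos ht (hv x hx)).trans_le ?_
      rw [Finset.mul_sum]
      exact Finset.sum_le_sum fun i _ => mul_le_mul_of_nonneg_right (hy i) (sqInner_nonneg _ _)
    exact_mod_cast h1
  have h2 := this.det_pos
  rw [← ofReal_frameDet] at h2
  exact_mod_cast h2

lemma multiAffine_frameDet (v : ι → n → ℂ) : MultiAffine (frameDet v) := by
  intro y i s
  have h := multiAffine_det_frameMatrix v (fun k => (y k : ℂ)) i s
  rw [bdiff_ofReal (f := frameDet v) (fun y => (ofReal_frameDet v y).symm)] at h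
  have e : (fun k => (y k : ℂ)) + Pi.single i (s : ℂ) =
      fun k => (((y + Pi.single i s : ι → ℝ) k : ℝ) : ℂ) := by
    funext k
    by_cases hk : k = i
    · subst hk; simp
    · simp [hk]
  rw [e] at h
  simp only [← ofReal_frameDet] at h
  exact_mod_cast h

lemma bdiff_frameDet_le {v : ι → n → ℂ} {y : ι → ℝ} {t ε : ℝ} (ht : 0 < t) (hε : 0 < ε)
    (hy : ∀ i, t ≤ y i) {i : ι} (hi : ∀ x, sqInner (v i) x ≤ ε * ∑ j, sqInner (v j) x) :
    bdiff (frameDet v) i y ≤ ε / t * frameDet v y := by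
  have hpsd : (frameMatrix v fun k => ((y + Pi.single i (-(t / ε)) : ι → ℝ) k : ℂ)).PosSemidef := by
    refine PosSemidef.of_dotProduct_mulVec_nonneg (frameMatrix_isHermitian v _) fun x => ?_
    rw [star_dotProduct_frameMatrix]
    have h1 : 0 ≤ ∑ k, (y + Pi.single i (-(t / ε)) : ι → ℝ) k * sqInner (v k) x := by
      simp only [Pi.add_apply, add_mul, Finset.sum_add_distrib]
      have e : ∑ k, (Pi.single i (-(t / ε)) : ι → ℝ) k * sqInner (v k) x =
          -(t / ε) * sqInner (v i) x := by
        rw [Finset.sum_eq_single i] <;> simp +contextual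
      have h2 : t * ∑ j, sqInner (v j) x ≤ ∑ j, y j * sqInner (v j) x := by
        rw [Finset.mul_sum]
        exact Finset.sum_le_sum fun i _ => mul_le_mul_of_nonneg_right (hy i) (sqInner_nonneg _ _)
      have h3 := mul_le_mul_of_nonneg_left (hi x) (div_pos ht hε).le
      have h4 : t / ε * (ε * ∑ j, sqInner (v j) x) = t * ∑ j, sqInner (v j) x := by
        field_simp
      rw [e]
      linarith
    exact_mod_cast h1
  have h5 := hpsd.det_nonneg
  rw [← ofReal_frameDet] at h5
  have h6 : 0 ≤ frameDet v (y + Pi.single i (-(t / ε))) := by exact_mod_cast h5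
  rw [multiAffine_frameDet] at h6
  have h7 : t / ε * bdiff (frameDet v) i y ≤ frameDet v y := by linarith
  have h8 := mul_le_mul_of_nonneg_left h7 (div_pos hε ht).le
  rwa [← mul_assoc, div_mul_div_cancel₀ ht.ne', div_self hε.ne', one_mul] at h8

/-- The product of the determinants belonging to the two halves of the variables. -/
def frameDetProd (v : ι → n → ℂ) (y : ι ⊕ ι → ℝ) : ℝ :=
  frameDet v (fun i => y (Sum.inl i)) * frameDet v fun i => y (Sum.inr i)

omit [Fintype ι] in
lemma MultiAffine.mul_sum {R : Type*} [CommRing R] {f g : (ι → R) → R} (hf : MultiAffine f)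
    (hg : MultiAffine g) :
    MultiAffine fun y : ι ⊕ ι → R => f (fun i => y (Sum.inl i)) * g fun i => y (Sum.inr i) := by
  have e1 : ∀ (y : ι ⊕ ι → R) i s, (fun k => (y + Pi.single (Sum.inl i) s : ι ⊕ ι → R) (Sum.inl k)) =
      (fun k => y (Sum.inl k)) + Pi.single i s := by
    intro y i s; funext k; simp [Pi.single_apply]
  have e2 : ∀ (y : ι ⊕ ι → R) i s, (fun k => (y + Pi.single (Sum.inr i) s : ι ⊕ ι → R) (Sum.inl k)) =
      (fun k => y (Sum.inl k)) := by
    intro y i s; funext k; simp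
  have e3 : ∀ (y : ι ⊕ ι → R) i s, (fun k => (y + Pi.single (Sum.inl i) s : ι ⊕ ι → R) (Sum.inr k)) =
      (fun k => y (Sum.inr k)) := by
    intro y i s; funext k; simp
  have e4 : ∀ (y : ι ⊕ ι → R) i s, (fun k => (y + Pi.single (Sum.inr i) s : ι ⊕ ι → R) (Sum.inr k)) =
      (fun k => y (Sum.inr k)) + Pi.single i s := by
    intro y i s; funext k; simp [Pi.single_apply]
  intro y k s
  have e : y - Pi.single k 1 = y + Pi.single k (-1) := by rw [sub_eq_add_neg, Pi.single_neg]
  rcases k with k | k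
  · simp only [_root_.bdiff, e, e1, e3]
    rw [hf, hf _ _ (-1)]; ring
  · simp only [_root_.bdiff, e, e2, e4]
    rw [hg, hg _ _ (-1)]; ring

lemma realStable_frameDetProd {v : ι → n → ℂ} (hv : ∀ x, x ≠ 0 → 0 < ∑ i, sqInner (v i) x) :
    RealStable (frameDetProd v) := by
  refine ⟨fun z => (frameMatrix v fun i => z (Sum.inl i)).det *
    (frameMatrix v fun i => z (Sum.inr i)).det,
    (multiAffine_det_frameMatrix v).mul_sum (multiAffine_det_frameMatrix v), ?_, ?_, ?_⟩
  · exact ((continuous_det_frameMatrix v).comp (by fun_prop)).mul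
      ((continuous_det_frameMatrix v).comp (by fun_prop))
  · exact fun z hz => mul_ne_zero (det_frameMatrix_ne_zero hv fun i => hz _)
      (det_frameMatrix_ne_zero hv fun i => hz _)
  · intro y
    simp only [frameDetProd, Complex.ofReal_mul, ofReal_frameDet]

lemma bdiff_frameDetProd_le {v : ι → n → ℂ} (hv : ∀ x, x ≠ 0 → 0 < ∑ i, sqInner (v i) x)
    {y : ι ⊕ ι → ℝ} {t ε : ℝ} (ht : 0 < t) (hε : 0 < ε) (hy : ∀ i, t ≤ y i)
    (hi : ∀ i x, sqInner (v i) x ≤ ε * ∑ j, sqInner (v j) x) (k : ι ⊕ ι) :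
    bdiff (frameDetProd v) k y ≤ ε / t * frameDetProd v y := by
  have p1 := frameDet_pos hv ht fun i => hy (Sum.inl i)
  have p2 := frameDet_pos hv ht fun i => hy (Sum.inr i)
  rcases k with k | k
  · have h := bdiff_frameDet_le ht hε (fun i => hy (Sum.inl i)) (hi k)
    have e : (fun i => (y - Pi.single (Sum.inl k) 1 : ι ⊕ ι → ℝ) (Sum.inl i)) =
        (fun i => y (Sum.inl i)) - Pi.single k 1 := by
      funext i; simp [Pi.single_apply]
    have e' : (fun i => (y - Pi.single (Sum.inl k) 1 : ι ⊕ ι → ℝ) (Sum.inr i)) =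
        fun i => y (Sum.inr i) := by
      funext i; simp
    have := mul_le_mul_of_nonneg_right h p2.le
    simp only [bdiff, frameDetProd, e, e'] at this ⊢
    linarith
  · have h := bdiff_frameDet_le ht hε (fun i => hy (Sum.inr i)) (hi k)
    have e : (fun i => (y - Pi.single (Sum.inr k) 1 : ι ⊕ ι → ℝ) (Sum.inr i)) =
        (fun i => y (Sum.inr i)) - Pi.single k 1 := by
      funext i; simp [Pi.single_apply]
    have e' : (fun i => (y - Pi.single (Sum.inr k) 1 : ι ⊕ ι → ℝ) (Sum.inl i)) =
        fun i => y (Sum.inl i) := by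
      funext i; simp
    have := mul_le_mul_of_nonneg_right h p1.le
    simp only [bdiff, frameDetProd, e, e'] at this ⊢
    linarith

omit [DecidableEq ι] in
/-- If `s ∑ i, v i (v i)ᴴ - ∑ i, c i • v i (v i)ᴴ` is nonsingular for all `s ≥ τ`, then it is
positive semidefinite for `s = τ`. -/
lemma sum_mul_sqInner_le {v : ι → n → ℂ} (hv : ∀ x, x ≠ 0 → 0 < ∑ i, sqInner (v i) x) {c : ι → ℝ}
    {τ : ℝ} (h : ∀ s, τ ≤ s → frameDet v (fun i => s - c i) ≠ 0) (x : n → ℂ) :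
    ∑ i, c i * sqInner (v i) x ≤ τ * ∑ i, sqInner (v i) x := by
  by_contra! hcon
  have hx : x ≠ 0 := by
    rintro rfl
    simp [sqInner] at hcon
  have hc : ∀ i, Continuous (sqInner (v i)) := by
    intro i
    unfold sqInner
    exact Complex.continuous_normSq.comp (by fun_prop)
  let ρ : (n → ℂ) → ℝ := fun x => (∑ i, c i * sqInner (v i) x) / ∑ i, sqInner (v i) x
  have hρ : ContinuousOn ρ (Metric.sphere 0 1) := by
    refine ContinuousOn.div (by fun_prop) (by fun_prop) fun u hu => (hv u ?_).ne'
    exact ne_zero_of_mem_unit_sphere ⟨u, hu⟩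
  have hscale : ∀ u : n → ℂ, u ≠ 0 → ((‖u‖⁻¹ : ℝ) : ℂ) • u ∈ Metric.sphere (0 : n → ℂ) 1 := by
    intro u hu
    rw [mem_sphere_zero_iff_norm, norm_smul, Complex.norm_real, norm_inv, norm_norm,
      inv_mul_cancel₀ (norm_ne_zero_iff.2 hu)]
  have hρs : ∀ u : n → ℂ, u ≠ 0 → ρ (((‖u‖⁻¹ : ℝ) : ℂ) • u) = ρ u := by
    intro u hu
    have hn : (‖u‖⁻¹) ^ 2 ≠ 0 := pow_ne_zero _ (inv_ne_zero (norm_ne_zero_iff.2 hu))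
    simp only [ρ, sqInner_smul, mul_left_comm (c _), ← Finset.mul_sum]
    rw [mul_div_mul_left _ _ hn]
  obtain ⟨u, hu, hmax⟩ := (isCompact_sphere (0 : n → ℂ) 1).exists_isMaxOn ⟨_, hscale x hx⟩ hρ
  have hu0 : u ≠ 0 := ne_zero_of_mem_unit_sphere ⟨u, hu⟩
  have hle : ∀ w, w ≠ 0 → ρ w ≤ ρ u := fun w hw => by
    rw [← hρs w hw]; exact hmax (hscale w hw)
  have hτ : τ ≤ ρ u := by
    refine le_trans ?_ (hle x hx)
    rw [le_div_iff₀ (hv x hx)]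
    exact hcon.le
  have hform : ∀ w, star w ⬝ᵥ ((frameMatrix v fun i => ((ρ u - c i : ℝ) : ℂ)) *ᵥ w) =
      ((ρ u * ∑ i, sqInner (v i) w - ∑ i, c i * sqInner (v i) w : ℝ) : ℂ) := by
    intro w
    rw [star_dotProduct_frameMatrix, Finset.mul_sum, ← Finset.sum_sub_distrib]
    push_cast
    exact Finset.sum_congr rfl fun i _ => by ring
  have hpsd : (frameMatrix v fun i => ((ρ u - c i : ℝ) : ℂ)).PosSemidef := by
    refine PosSemidef.of_dotProduct_mulVec_nonneg (frameMatrix_isHermitian v _) fun w => ?_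
    rw [hform]
    have : 0 ≤ ρ u * ∑ i, sqInner (v i) w - ∑ i, c i * sqInner (v i) w := by
      by_cases hw : w = 0
      · subst hw; simp [sqInner]
      · have := hle w hw
        rw [div_le_iff₀ (hv w hw)] at this
        linarith
    exact_mod_cast this
  have hzero := (hpsd.dotProduct_mulVec_zero_iff u).1 (by
    rw [hform]
    have : ρ u * ∑ i, sqInner (v i) u = ∑ i, c i * sqInner (v i) u :=
      div_mul_cancel₀ _ (hv u hu0).ne'
    rw [this]; simp)
  have hdet := exists_mulVec_eq_zero_iff.1 ⟨u, hu0, hzero⟩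
  exact h _ hτ (by unfold frameDet; rw [hdet]; rfl)

/-- The Marcus–Spielman–Srivastava partition theorem: a frame whose vectors are all small relative
to the frame operator can be split into two halves of almost equal frame operators. -/
theorem exists_balanced_partition {v : ι → n → ℂ} (hv : ∀ x, x ≠ 0 → 0 < ∑ i, sqInner (v i) x)
    {u : ℝ} (hu : 0 < u) (hi : ∀ i x, sqInner (v i) x ≤ u ^ 2 * ∑ j, sqInner (v j) x) :
    ∃ S : Finset ι, ∀ x,
      ∑ i ∈ S, sqInner (v i) x ≤ (1 / 2 + 3 / 2 * u + u ^ 2) * ∑ i, sqInner (v i) x ∧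
      ∑ i ∈ Sᶜ, sqInner (v i) x ≤ (1 / 2 + 3 / 2 * u + u ^ 2) * ∑ i, sqInner (v i) x := by
  have ht : 0 < u + u ^ 2 := by positivity
  have hφ : 2 * (u ^ 2 / (u + u ^ 2)) * (1 / 2 + u / 2) ≤ 2 * (1 / 2 + u / 2) - 1 := by
    have : u ^ 2 / (u + u ^ 2) = u / (1 + u) := by
      field_simp
    rw [this]
    apply le_of_eq
    field_simp
    ring
  obtain ⟨S, hS⟩ := exists_partition_pos (realStable_frameDetProd hv) (t := u + u ^ 2)
    (δ := 1 / 2 + u / 2) (by positivity) hφ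
    (fun y hy => mul_pos (frameDet_pos hv ht fun i => hy (Sum.inl i))
      (frameDet_pos hv ht fun i => hy (Sum.inr i)))
    (fun y hy => bdiff_frameDetProd_le hv ht (by positivity) hy hi)
  have hS' : ∀ s, 1 / 2 + 3 / 2 * u + u ^ 2 ≤ s → 0 <
      frameDet v (fun i => s - if i ∈ S then 1 else 0) *
        frameDet v (fun i => s - if i ∈ Sᶜ then 1 else 0) := by
    intro s hs
    convert hS s (by linarith) using 1
    simp only [frameDetProd, Sum.elim_inl, Sum.elim_inr, Finset.mem_compl]
    congr 2 <;> funext i <;> by_cases h : i ∈ S <;> simp [h]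
  refine ⟨S, fun x => ⟨?_, ?_⟩⟩
  · have := sum_mul_sqInner_le hv (fun s hs => left_ne_zero_of_mul (hS' s hs).ne') x
    simpa [Finset.sum_ite_mem] using this
  · have := sum_mul_sqInner_le hv (fun s hs => right_ne_zero_of_mul (hS' s hs).ne') x
    simpa only [ite_mul, one_mul, zero_mul, Finset.sum_ite_mem, Finset.univ_inter] using this

end Determinant

section Halving

open Matrix

variable {ι n : Type*} [Fintype ι] [DecidableEq ι] [Fintype n] [DecidableEq n]

omit [DecidableEq n] in
lemma sqInner_le (v x : n → ℂ) :
    sqInner v x ≤ (∑ k, Complex.normSq (v k)) * ∑ k, Complex.normSq (x k) := by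
  have h1 : ‖star v ⬝ᵥ x‖ ≤ ∑ k, ‖v k‖ * ‖x k‖ := by
    refine (norm_sum_le _ _).trans_eq ?_
    simp
  have h2 := Finset.sum_mul_sq_le_sq_mul_sq Finset.univ (fun k => ‖v k‖) fun k => ‖x k‖
  simp only [sqInner, Complex.normSq_eq_norm_sq]
  exact (pow_le_pow_left₀ (norm_nonneg _) h1 2).trans h2

omit [Fintype ι] in
lemma exists_half_subframe {v : ι → n → ℂ} {D a b u : ℝ}
    (hD : ∀ i x, sqInner (v i) x ≤ D * ∑ k, Complex.normSq (x k)) (X : Finset ι) (ha : 0 < a)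
    (hu : 0 < u) (hu4 : u ≤ 1 / 4) (hDu : D ≤ u ^ 2 * a)
    (hX : ∀ x, a * ∑ k, Complex.normSq (x k) ≤ ∑ i ∈ X, sqInner (v i) x ∧
      ∑ i ∈ X, sqInner (v i) x ≤ b * ∑ k, Complex.normSq (x k)) :
    ∃ S : Finset ι, ∀ x,
      a * (1 / 2 - 3 / 2 * u - u ^ 2) * ∑ k, Complex.normSq (x k) ≤ ∑ i ∈ S, sqInner (v i) x ∧
      ∑ i ∈ S, sqInner (v i) x ≤
        b * (1 / 2 + 3 / 2 * u + u ^ 2) * ∑ k, Complex.normSq (x k) := by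
  have hN : ∀ x : n → ℂ, 0 ≤ ∑ k, Complex.normSq (x k) := fun x =>
    Finset.sum_nonneg fun _ _ => Complex.normSq_nonneg _
  have hsum : ∀ x, ∑ i : X, sqInner (v i) x = ∑ i ∈ X, sqInner (v i) x := fun x =>
    Finset.sum_coe_sort X fun i => sqInner (v i) x
  obtain ⟨S, hS⟩ := exists_balanced_partition (v := fun i : X => v i) (u := u)
    (fun x hx => by
      obtain ⟨k, hk⟩ := Function.ne_iff.1 hx
      have : 0 < ∑ k, Complex.normSq (x k) :=
        Finset.sum_pos' (fun _ _ => Complex.normSq_nonneg _) ⟨k, by simp, Complex.normSq_pos.2 hk⟩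
      rw [hsum]
      exact (mul_pos ha this).trans_le (hX x).1) hu
    (fun i x => by
      rw [hsum]
      calc sqInner (v i) x ≤ D * ∑ k, Complex.normSq (x k) := hD _ _
        _ ≤ u ^ 2 * a * ∑ k, Complex.normSq (x k) := mul_le_mul_of_nonneg_right hDu (hN x)
        _ = u ^ 2 * (a * ∑ k, Complex.normSq (x k)) := mul_assoc _ _ _
        _ ≤ _ := mul_le_mul_of_nonneg_left (hX x).1 (sq_nonneg u))
  refine ⟨S.map (Function.Embedding.subtype _), fun x => ?_⟩
  obtain ⟨h1, h2⟩ := hS x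
  have h3 := Finset.sum_add_sum_compl S fun i : X => sqInner (v i) x
  rw [hsum] at h1 h2 h3
  obtain ⟨h4, h5⟩ := hX x
  rw [Finset.sum_map]
  simp only [Function.Embedding.coe_subtype]
  have c1 : 0 ≤ 1 / 2 - 3 / 2 * u - u ^ 2 := by nlinarith
  have c2 : 0 ≤ 1 / 2 + 3 / 2 * u + u ^ 2 := by positivity
  have h6 := mul_le_mul_of_nonneg_left h4 c1
  have h7 := mul_le_mul_of_nonneg_left h5 c2
  constructor <;> linarith

omit [Fintype ι] in
lemma exists_small_subframe {v : ι → n → ℂ} {D : ℝ} (hD0 : 0 < D)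
    (hD : ∀ i x, sqInner (v i) x ≤ D * ∑ k, Complex.normSq (x k)) (m : ℕ) (X : Finset ι) {a b : ℝ}
    (ha : 400 * D ≤ a) (ham : a ≤ 2 ^ m * (10000 * D)) (hab : b ≤ a * (1 + 20 * √(D / a)))
    (hX : ∀ x, a * ∑ k, Complex.normSq (x k) ≤ ∑ i ∈ X, sqInner (v i) x ∧
      ∑ i ∈ X, sqInner (v i) x ≤ b * ∑ k, Complex.normSq (x k)) :
    ∃ (S : Finset ι) (a' b' : ℝ), b' ≤ 2 * a' ∧ b' ≤ 20000 * D ∧ 0 < a' ∧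
      ∀ x, a' * ∑ k, Complex.normSq (x k) ≤ ∑ i ∈ S, sqInner (v i) x ∧
        ∑ i ∈ S, sqInner (v i) x ≤ b' * ∑ k, Complex.normSq (x k) := by
  induction m generalizing X a b with
  | zero =>
    have ha0 : 0 < a := by linarith
    have h1 : √(D / a) ≤ 1 / 20 := by
      rw [Real.sqrt_le_left (by norm_num), div_le_iff₀ ha0]
      linarith
    have h2 : a * (1 + 20 * √(D / a)) ≤ a * 2 := mul_le_mul_of_nonneg_left (by linarith) ha0.le
    exact ⟨X, a, b, by linarith, by linarith, ha0, hX⟩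
  | succ m ih =>
    by_cases hle : a ≤ 2 ^ m * (10000 * D)
    · exact ih X ha hle hab hX
    have hpow : (1 : ℝ) ≤ 2 ^ m := one_le_pow₀ (by norm_num)
    have ha4 : 10000 * D ≤ a := by nlinarith
    have ha0 : 0 < a := by linarith
    set u := √(D / a) with hu
    have hu0 : 0 < u := Real.sqrt_pos.2 (by positivity)
    have hu2 : u ^ 2 * a = D := by
      rw [hu, Real.sq_sqrt (by positivity), div_mul_cancel₀ _ ha0.ne']
    have hu1 : u ≤ 1 / 100 := by
      rw [hu, Real.sqrt_le_left (by norm_num), div_le_iff₀ ha0]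
      linarith
    obtain ⟨S, hS⟩ := exists_half_subframe hD X ha0 hu0 (by linarith) hu2.ge hX
    have hc : 2 / 5 ≤ 1 / 2 - 3 / 2 * u - u ^ 2 := by nlinarith
    have ha' : a * (2 / 5) ≤ a * (1 / 2 - 3 / 2 * u - u ^ 2) := mul_le_mul_of_nonneg_left hc ha0.le
    have ha'' : a * (1 / 2 - 3 / 2 * u - u ^ 2) ≤ a * (1 / 2) :=
      mul_le_mul_of_nonneg_left (by nlinarith) ha0.le
    refine ih S (by linarith) (by rw [pow_succ] at ham; linarith) ?_ hS
    have hu' : 141 / 100 * u ≤ √(D / (a * (1 / 2 - 3 / 2 * u - u ^ 2))) := by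
      rw [Real.le_sqrt' (by positivity), le_div_iff₀ (by linarith), ← hu2]
      nlinarith [mul_pos (sq_pos_of_pos hu0) ha0]
    calc b * (1 / 2 + 3 / 2 * u + u ^ 2)
        ≤ a * (1 + 20 * u) * (1 / 2 + 3 / 2 * u + u ^ 2) :=
          mul_le_mul_of_nonneg_right hab (by positivity)
      _ = a * ((1 + 20 * u) * (1 / 2 + 3 / 2 * u + u ^ 2)) := mul_assoc _ _ _
      _ ≤ a * ((1 / 2 - 3 / 2 * u - u ^ 2) * (1 + 20 * (141 / 100 * u))) := by
          refine mul_le_mul_of_nonneg_left ?_ ha0.le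
          have : 0 ≤ u * (1 / 100 - u) := mul_nonneg hu0.le (by linarith)
          nlinarith [mul_nonneg hu0.le this]
      _ = a * (1 / 2 - 3 / 2 * u - u ^ 2) * (1 + 20 * (141 / 100 * u)) := (mul_assoc _ _ _).symm
      _ ≤ _ := mul_le_mul_of_nonneg_left (by linarith) (by linarith)

/-- A tight frame with unimodular coordinates contains a subframe of proportional size whose frame
operator is comparable to the identity. -/
theorem exists_proportional_subframe [Nonempty n] {v : ι → n → ℂ}
    (hv : ∀ i k, Complex.normSq (v i k) = 1) {M : ℝ} (hM : 400 * Fintype.card n ≤ M)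
    (hX : ∀ x, ∑ i, sqInner (v i) x = M * ∑ k, Complex.normSq (x k)) :
    ∃ S : Finset ι, 0 < S.card ∧ (S.card : ℝ) ≤ 20000 * Fintype.card n ∧ ∀ x,
      1 / 2 * S.card * ∑ k, Complex.normSq (x k) ≤ ∑ i ∈ S, sqInner (v i) x ∧
        ∑ i ∈ S, sqInner (v i) x ≤ 2 * S.card * ∑ k, Complex.normSq (x k) := by
  have hN : ∀ x : n → ℂ, 0 ≤ ∑ k, Complex.normSq (x k) := fun x =>
    Finset.sum_nonneg fun _ _ => Complex.normSq_nonneg _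
  have hD0 : (0 : ℝ) < Fintype.card n := by exact_mod_cast Fintype.card_pos
  obtain ⟨m, hm⟩ := pow_unbounded_of_one_lt M (one_lt_two : (1 : ℝ) < 2)
  have hone : (1 : ℝ) ≤ Fintype.card n := by exact_mod_cast Fintype.card_pos
  obtain ⟨S, a, b, hab, hb, ha, hS⟩ := exists_small_subframe (v := v) hD0
    (fun i x => by simpa [hv] using sqInner_le (v i) x) m Finset.univ (a := M) (b := M) hM
    (by nlinarith [pow_pos (two_pos : (0 : ℝ) < 2) m])
    (by nlinarith [Real.sqrt_nonneg (Fintype.card n / M)]) (fun x => ⟨(hX x).ge, (hX x).le⟩)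
  have hbasis : ∀ k : n, ∑ j, Complex.normSq ((Pi.single k 1 : n → ℂ) j) = 1 := by
    intro k
    rw [Finset.sum_eq_single k] <;> simp +contextual
  have hsq : ∀ i (k : n), sqInner (v i) (Pi.single k 1) = 1 := by
    intro i k
    simp [sqInner, hv]
  have hcard : a ≤ S.card ∧ (S.card : ℝ) ≤ b := by
    have := hS (Pi.single (Classical.arbitrary n) 1)
    simpa [hbasis, hsq] using this
  refine ⟨S, by exact_mod_cast ha.trans_le hcard.1, by linarith, fun x => ⟨?_, ?_⟩⟩
  · exact (mul_le_mul_of_nonneg_right (by linarith) (hN x)).trans (hS x).1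
  · exact (hS x).2.trans (mul_le_mul_of_nonneg_right (by linarith) (hN x))

end Halving

section Trigonometric

open Matrix

lemma continuous_trigChar {d : ℕ} (k : Fin d → ℤ) : Continuous (trigChar k) := by
  unfold trigChar
  fun_prop

lemma trigChar_mul_conj {d : ℕ} (k l : Fin d → ℤ) (x : Torus d) :
    trigChar k x * (starRingEnd ℂ) (trigChar l x) = ∏ j, fourier (k j - l j) (x j) := by
  simp only [trigChar, map_prod, ← Finset.prod_mul_distrib, ← fourier_neg, ← fourier_add,
    sub_eq_add_neg]

lemma normSq_trigChar {d : ℕ} (k : Fin d → ℤ) (x : Torus d) :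
    Complex.normSq (trigChar k x) = 1 := by
  have h := trigChar_mul_conj k k x
  rw [Complex.mul_conj] at h
  simp only [sub_self, fourier_zero, Finset.prod_const_one] at h
  exact_mod_cast h

lemma integral_fourier (k : ℤ) :
    ∫ x : AddCircle (2 * π), fourier k x = if k = 0 then ((2 * π : ℝ) : ℂ) else 0 := by
  have h := congrFun (fourierCoeff_fourier (T := 2 * π) k) 0
  simp only [fourierCoeff, neg_zero, fourier_zero, one_smul] at h
  rw [AddCircle.volume_eq_smul_haarAddCircle, integral_smul_measure, h,
    ENNReal.toReal_ofReal (by positivity), Pi.single_apply]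
  by_cases hk : k = 0 <;> simp [hk, eq_comm]

lemma integral_trigChar_mul_conj {d : ℕ} (k l : Fin d → ℤ) :
    ∫ x, trigChar k x * (starRingEnd ℂ) (trigChar l x) =
      if k = l then (((2 * π) ^ d : ℝ) : ℂ) else 0 := by
  simp only [trigChar_mul_conj]
  rw [integral_fintype_prod_volume_eq_prod fun j (x : AddCircle (2 * π)) =>
    (fourier (k j - l j) x : ℂ)]
  simp only [integral_fourier, sub_eq_zero]
  rw [Finset.prod_ite_zero]
  simp [funext_iff]

/-- Parseval's identity for a finite orthogonal family of functions of equal norms. -/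
lemma integral_normSq_sum {α n : Type*} [MeasurableSpace α] {μ : Measure α} [Fintype n]
    [DecidableEq n] {χ : n → α → ℂ} {A : ℝ}
    (hint : ∀ k l, Integrable (fun x => χ k x * (starRingEnd ℂ) (χ l x)) μ)
    (horth : ∀ k l, ∫ x, χ k x * (starRingEnd ℂ) (χ l x) ∂μ = if k = l then (A : ℂ) else 0)
    (c : n → ℂ) :
    ∫ x, Complex.normSq (∑ k, c k * χ k x) ∂μ = A * ∑ k, Complex.normSq (c k) := by
  have e : ∀ x, (Complex.normSq (∑ k, c k * χ k x) : ℂ) =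
      ∑ k, ∑ l, (c k * (starRingEnd ℂ) (c l)) * (χ k x * (starRingEnd ℂ) (χ l x)) := by
    intro x
    rw [← Complex.mul_conj, map_sum, Finset.sum_mul_sum]
    refine Finset.sum_congr rfl fun k _ => Finset.sum_congr rfl fun l _ => ?_
    rw [map_mul]
    ring
  have h : ((∫ x, Complex.normSq (∑ k, c k * χ k x) ∂μ : ℝ) : ℂ) =
      ((A * ∑ k, Complex.normSq (c k) : ℝ) : ℂ) := by
    rw [← integral_complex_ofReal]
    simp only [e]
    rw [integral_finsetSum _ fun k _ => integrable_finsetSum _ fun l _ => (hint k l).const_mul _]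
    simp only [integral_finsetSum _ fun l _ => (hint _ l).const_mul _, integral_const_mul, horth,
      mul_ite, mul_zero, Finset.sum_ite_eq, Finset.mem_univ, if_true, Complex.mul_conj]
    push_cast
    rw [← Finset.sum_mul, mul_comm]
  exact_mod_cast h

lemma nnnorm_sq_eq_ofReal_normSq (z : ℂ) :
    (‖z‖₊ : ℝ≥0∞) ^ 2 = ENNReal.ofReal (Complex.normSq z) := by
  rw [Complex.normSq_eq_norm_sq, ENNReal.ofReal_pow (norm_nonneg _), ofReal_norm]
  rfl

lemma lintegral_nnnorm_sq_trigSum {d : ℕ} (Q : Finset (Fin d → ℤ)) (c : Q → ℂ) :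
    ∫⁻ x, (‖∑ k : Q, c k * trigChar k.1 x‖₊ : ℝ≥0∞) ^ 2 ∂(torusMeasure d) =
      ENNReal.ofReal (∑ k, Complex.normSq (c k)) := by
  have hc : ∀ k l : Q, Continuous fun x => trigChar k.1 x * (starRingEnd ℂ) (trigChar l.1 x) :=
    fun k l => (continuous_trigChar _).mul (Complex.continuous_conj.comp (continuous_trigChar _))
  have hs : Continuous fun x : Torus d => Complex.normSq (∑ k : Q, c k * trigChar k.1 x) :=
    Complex.continuous_normSq.comp
      (continuous_finsetSum _ fun k _ => continuous_const.mul (continuous_trigChar _))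
  have hint : ∀ {E : Type} [NormedAddCommGroup E] {f : Torus d → E}, Continuous f → Integrable f :=
    fun hf => hf.integrable_of_hasCompactSupport (HasCompactSupport.of_compactSpace _)
  have h := integral_normSq_sum (μ := (volume : Measure (Torus d)))
    (χ := fun k : Q => trigChar k.1) (A := (2 * π) ^ d) (fun k l => hint (hc k l))
    (fun k l => by
      rw [integral_trigChar_mul_conj]
      simp only [Subtype.ext_iff]) c
  simp only [nnnorm_sq_eq_ofReal_normSq]
  rw [torusMeasure, lintegral_smul_measure, ← ofReal_integral_eq_lintegral_ofReal (hint hs)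
    (Filter.Eventually.of_forall fun _ => Complex.normSq_nonneg _), h, smul_eq_mul,
    ENNReal.ofReal_mul (by positivity), ← mul_assoc, ENNReal.inv_mul_cancel, one_mul]
  · simp only [ne_eq, ENNReal.ofReal_eq_zero, not_le]; positivity
  · exact ENNReal.ofReal_ne_top

/-- The point of the torus with coordinates `2π g_j / N`. -/
def gridPoint {d N : ℕ} (g : Fin d → ZMod N) : Torus d :=
  fun j => ((2 * π * ((g j).val / N) : ℝ) : AddCircle (2 * π))

lemma fourier_gridPoint {d N : ℕ} [NeZero N] (k : ℤ) (g : Fin d → ZMod N) (j : Fin d) :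
    (fourier k (gridPoint g j) : ℂ) = ZMod.stdAddChar (g j * (k : ZMod N)) := by
  have e : g j * (k : ZMod N) = (((g j).val * k : ℤ) : ZMod N) := by simp
  rw [e, ZMod.stdAddChar_coe, gridPoint, fourier_coe_apply]
  congr 1
  have : (π : ℂ) ≠ 0 := by exact_mod_cast Real.pi_ne_zero
  push_cast
  field_simp

lemma sum_gridPoint_trigChar_mul_conj {d N : ℕ} [NeZero N] {k l : Fin d → ℤ}
    (hkl : ∀ j, ((k j - l j : ℤ) : ZMod N) = 0 → k j = l j) :
    ∑ g : Fin d → ZMod N, trigChar k (gridPoint g) * (starRingEnd ℂ) (trigChar l (gridPoint g)) =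
      if k = l then (N : ℂ) ^ d else 0 := by
  simp only [trigChar_mul_conj, fourier_gridPoint]
  rw [← Fintype.piFinset_univ, ← Finset.prod_univ_sum (fun _ => Finset.univ)
    fun j (t : ZMod N) => ZMod.stdAddChar (t * ((k j - l j : ℤ) : ZMod N))]
  simp only [AddChar.sum_mulShift _ (ZMod.isPrimitive_stdAddChar N), ZMod.card]
  have : ∀ j, ((k j - l j : ℤ) : ZMod N) = 0 ↔ k j = l j :=
    fun j => ⟨hkl j, fun h => by simp [h]⟩
  simp only [this, Nat.cast_ite, Nat.cast_zero]
  rw [Finset.prod_ite_zero]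
  simp [funext_iff]

lemma exists_modulus {d : ℕ} (Q : Finset (Fin d → ℤ)) :
    ∃ N : ℕ, N ≠ 0 ∧ ∀ k ∈ Q, ∀ l ∈ Q, ∀ j, ((k j - l j : ℤ) : ZMod N) = 0 → k j = l j := by
  let B : ℕ := ∑ k ∈ Q, ∑ j, (k j).natAbs
  have hB : ∀ k ∈ Q, ∀ j, (k j).natAbs ≤ B := fun k hk j =>
    (Finset.single_le_sum (f := fun j => (k j).natAbs) (by simp) (Finset.mem_univ j)).trans
      (Finset.single_le_sum (f := fun k => ∑ j, (k j).natAbs) (by simp) hk)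
  refine ⟨2 * B + 1, by simp, fun k hk l hl j h => ?_⟩
  rw [ZMod.intCast_zmod_eq_zero_iff_dvd] at h
  have h1 := hB k hk j
  have h2 := hB l hl j
  have := Int.eq_zero_of_abs_lt_dvd h (by rw [abs_lt]; push_cast; omega)
  omega

lemma exists_discretization {d : ℕ} (Q : Finset (Fin d → ℤ)) (hQ : Q.Nonempty) :
    ∃ m : ℕ, 0 < m ∧ (m : ℝ) ≤ 20000 * Q.card ∧ ∃ ξ : Fin m → Torus d, ∀ c : Q → ℂ,
      1 / 2 * m * ∑ k, Complex.normSq (c k) ≤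
          ∑ j, Complex.normSq (∑ k : Q, c k * trigChar k.1 (ξ j)) ∧
        ∑ j, Complex.normSq (∑ k : Q, c k * trigChar k.1 (ξ j)) ≤
          2 * m * ∑ k, Complex.normSq (c k) := by
  obtain ⟨N, hN, hNQ⟩ := exists_modulus Q
  have : NeZero N := ⟨hN⟩
  have : Nonempty Q := hQ.to_subtype
  let v : (Fin d → ZMod N) × Fin (400 * Q.card) → Q → ℂ :=
    fun i k => (starRingEnd ℂ) (trigChar k.1 (gridPoint i.1))
  have hv : ∀ i c, sqInner (v i) c =
      Complex.normSq (∑ k : Q, c k * trigChar k.1 (gridPoint i.1)) := by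
    intro i c
    simp [sqInner, v, dotProduct, mul_comm]
  have hgrid : ∀ c : Q → ℂ, ∑ g : Fin d → ZMod N,
      Complex.normSq (∑ k : Q, c k * trigChar k.1 (gridPoint g)) =
        (N : ℝ) ^ d * ∑ k, Complex.normSq (c k) := by
    intro c
    let : MeasurableSpace (Fin d → ZMod N) := ⊤
    have : MeasurableSingletonClass (Fin d → ZMod N) := ⟨fun _ => trivial⟩
    have := integral_normSq_sum (μ := (Measure.count : Measure (Fin d → ZMod N)))
      (χ := fun (k : Q) g => trigChar k.1 (gridPoint g)) (A := (N : ℝ) ^ d)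
      (fun k l => Integrable.of_finite) (fun k l => by
        rw [integral_count, sum_gridPoint_trigChar_mul_conj (hNQ _ k.2 _ l.2)]
        simp only [Subtype.ext_iff]
        push_cast
        rfl) c
    rwa [integral_count] at this
  obtain ⟨S, hS0, hScard, hS⟩ := exists_proportional_subframe (v := v)
    (M := (N : ℝ) ^ d * (400 * Q.card))
    (fun i k => by simp only [v, Complex.normSq_conj, normSq_trigChar])
    (by
      rw [Fintype.card_coe]
      have : (1 : ℝ) ≤ (N : ℝ) ^ d := one_le_pow₀ (by exact_mod_cast Nat.one_le_iff_ne_zero.2 hN)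
      exact le_mul_of_one_le_left (by positivity) this)
    (fun c => by
      simp only [hv, Fintype.sum_prod_type_right, hgrid, Finset.sum_const, Finset.card_univ,
        Fintype.card_fin, nsmul_eq_mul]
      push_cast
      ring)
  rw [Fintype.card_coe] at hScard
  refine ⟨S.card, hS0, hScard, fun j => gridPoint (S.equivFin.symm j).1.1, fun c => ?_⟩
  have e : ∑ j, Complex.normSq (∑ k : Q, c k * trigChar k.1
      (gridPoint (S.equivFin.symm j).1.1)) = ∑ i ∈ S, sqInner (v i) c := by
    rw [← Finset.sum_coe_sort S, ← S.equivFin.symm.sum_comp]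
    simp only [hv]
  rw [e]
  exact hS c

end Trigonometric

/-- **Discretization for trigonometric polynomials.** There are three positive absolute
constants `C₁`, `C₂`, `C₃` such that for any `d ∈ ℕ` and any finite `Q ⊆ ℤ^d` there is a set
of `m ≤ C₁ |Q|` points `ξ^1,…,ξ^m ∈ 𝕋^d` with
`C₂ ‖f‖₂² ≤ (1/m) ∑_j |f(ξ^j)|² ≤ C₃ ‖f‖₂²` for every `f ∈ T(Q)`. -/
theorem discretization_trigonometric :
    ∃ C₁ C₂ C₃ : ℝ, 0 < C₁ ∧ 0 < C₂ ∧ 0 < C₃ ∧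
      ∀ (d : ℕ) (Q : Finset (Fin d → ℤ)),
        ∃ m : ℕ, (m : ℝ) ≤ C₁ * Q.card ∧
          ∃ ξ : Fin m → Torus d,
            ∀ f ∈ trigPoly Q,
              ENNReal.ofReal C₂ * ∫⁻ x, (‖f x‖₊ : ℝ≥0∞) ^ 2 ∂(torusMeasure d) ≤
                  (m : ℝ≥0∞)⁻¹ * ∑ j, (‖f (ξ j)‖₊ : ℝ≥0∞) ^ 2 ∧
                (m : ℝ≥0∞)⁻¹ * ∑ j, (‖f (ξ j)‖₊ : ℝ≥0∞) ^ 2 ≤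
                  ENNReal.ofReal C₃ * ∫⁻ x, (‖f x‖₊ : ℝ≥0∞) ^ 2 ∂(torusMeasure d) := by
  refine ⟨20000, 1 / 2, 2, by norm_num, by norm_num, by norm_num, fun d Q => ?_⟩
  have hpoly : ∀ f ∈ trigPoly Q, ∃ c : Q → ℂ, f = fun x => ∑ k : Q, c k * trigChar k.1 x := by
    intro f hf
    obtain ⟨c, rfl⟩ := (Submodule.mem_span_image_finset_iff_exists_fun ℂ).1 hf
    exact ⟨c, by funext x; simp⟩
  rcases Q.eq_empty_or_nonempty with rfl | hQ
  · refine ⟨0, by simp, Fin.elim0, fun f hf => ?_⟩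
    obtain ⟨c, rfl⟩ := hpoly f hf
    simp
  obtain ⟨m, hm, hmQ, ξ, hξ⟩ := exists_discretization Q hQ
  refine ⟨m, hmQ, ξ, fun f hf => ?_⟩
  obtain ⟨c, rfl⟩ := hpoly f hf
  obtain ⟨h1, h2⟩ := hξ c
  have hm' : (0 : ℝ) < m := by exact_mod_cast hm
  simp only [lintegral_nnnorm_sq_trigSum]
  simp only [nnnorm_sq_eq_ofReal_normSq]
  rw [← ENNReal.ofReal_sum_of_nonneg fun _ _ => Complex.normSq_nonneg _, ← ENNReal.ofReal_natCast,
    ← ENNReal.ofReal_inv_of_pos hm', ← ENNReal.ofReal_mul (by positivity),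
    ← ENNReal.ofReal_mul (by positivity), ← ENNReal.ofReal_mul (by positivity)]
  constructor <;> refine ENNReal.ofReal_le_ofReal ?_
  · rw [le_inv_mul_iff₀ hm']
    linarith
  · rw [inv_mul_le_iff₀ hm']
    linarith

end
end
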